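/- arXiv:2008.09139 — 11 statements merged into one kernel-verified Lean document; each statement's English description precedes it below -/
import Mathlib

section
/- In the polynomial ring R = F_q[x_1,x_2,y_1,y_2], the relation (T_0) holds: c_0·u_0 − c_1·u_1 + u_2 = 0. -/
open MvPolynomial

/-- Relation (T₀): `c₀·u₀ − c₁·u₁ + u₂ = 0` in `F_q[x₁,x₂,y₁,y₂]`. -/
theorem stmt_0 (p e q : ℕ) (hp : p.Prime) (he : 1 ≤ e) (hq : q = p ^ e)
    (F : Type) [Field F] [Fintype F] (hF : Fintype.card F = q)
    (x1 x2 y1 y2 d1 d2 c0 c1 u0 u1 u2 : MvPolynomial (Fin 4) F)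
    (hx1 : x1 = X 0) (hx2 : x2 = X 1) (hy1 : y1 = X 2) (hy2 : y2 = X 3)
    (hd1 : d1 = x1 * x2 ^ q ^ 2 - x2 * x1 ^ q ^ 2)
    (hd2 : d2 = x1 * x2 ^ q - x2 * x1 ^ q)
    (hc0 : c0 = d2 ^ (q - 1))
    (hc1 : c1 * d2 = d1)
    (hu0 : u0 = x1 * y1 + x2 * y2)
    (hu1 : u1 = x1 ^ q * y1 + x2 ^ q * y2)
    (hu2 : u2 = x1 ^ q ^ 2 * y1 + x2 ^ q ^ 2 * y2) :
    c0 * u0 - c1 * u1 + u2 = 0 := by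
  haveI : Fact p.Prime := ⟨hp⟩
  haveI : CharP F p := charP_of_card_eq_prime_pow (hF.trans hq)
  have hq1 : 1 < q := by
    rw [hq]; exact Nat.one_lt_pow (by omega) hp.one_lt
  have hne : d2 ≠ 0 := by
    intro h
    have h2 := congrArg (aeval (fun i : Fin 4 => if i = 0 then (1 : Polynomial F) else Polynomial.X)) h
    rw [hd2, hx1, hx2] at h2
    simp at h2
    exact FiniteField.X_pow_card_sub_X_ne_zero F hq1 h2
  have hd2q : d2 ^ q = x1 ^ q * x2 ^ q ^ 2 - x2 ^ q * x1 ^ q ^ 2 := by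
    have h : d2 ^ q = (x1 * x2 ^ q) ^ q - (x2 * x1 ^ q) ^ q := by
      rw [hd2, hq]; exact sub_pow_char_pow _ _ _
    rw [h, mul_pow, mul_pow, ← pow_mul, ← pow_mul, ← sq]
  have hc : d2 * c0 = d2 ^ q := by
    rw [hc0, ← pow_succ', Nat.sub_add_cancel hq1.le]
  apply (mul_eq_zero.mp _).resolve_left hne
  have : d2 * (c0 * u0 - c1 * u1 + u2) = (d2 * c0) * u0 - (c1 * d2) * u1 + d2 * u2 := by ring
  rw [this, hc, hd2q, hc1, hd1, hd2, hu0, hu1, hu2]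
  generalize x1 ^ q ^ 2 = A
  generalize x2 ^ q ^ 2 = B
  ring
end

section
/- In the polynomial ring R = F_q[x_1,x_2,y_1,y_2], the relation (T_1) holds: c_0·u_{−1} − c_1·u_0^q + u_1^q = 0. -/
open MvPolynomial

/-- Relation (T₁): `c₀·u₋₁ − c₁·u₀^q + u₁^q = 0` in `F_q[x₁,x₂,y₁,y₂]`. -/
theorem stmt_1 (p e q : ℕ) (hp : p.Prime) (he : 1 ≤ e) (hq : q = p ^ e)
    (F : Type) [Field F] [Fintype F] (hF : Fintype.card F = q)
    (x1 x2 y1 y2 d1 d2 c0 c1 um1 u0 u1 : MvPolynomial (Fin 4) F)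
    (hx1 : x1 = X 0) (hx2 : x2 = X 1) (hy1 : y1 = X 2) (hy2 : y2 = X 3)
    (hd1 : d1 = x1 * x2 ^ q ^ 2 - x2 * x1 ^ q ^ 2)
    (hd2 : d2 = x1 * x2 ^ q - x2 * x1 ^ q)
    (hc0 : c0 = d2 ^ (q - 1))
    (hc1 : c1 * d2 = d1)
    (hum1 : um1 = x1 * y1 ^ q + x2 * y2 ^ q)
    (hu0 : u0 = x1 * y1 + x2 * y2)
    (hu1 : u1 = x1 ^ q * y1 + x2 ^ q * y2) :
    c0 * um1 - c1 * u0 ^ q + u1 ^ q = 0 := by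
  have hF' : Fintype.card F = p ^ e := hF.trans hq
  have : Fact p.Prime := ⟨hp⟩
  have : CharP F p := charP_of_card_eq_prime_pow hF'
  have hq1 : 1 < q := hF ▸ Fintype.one_lt_card
  have hadd : ∀ a b : MvPolynomial (Fin 4) F, (a + b) ^ q = a ^ q + b ^ q := by
    intro a b
    rw [hq]
    exact add_pow_char_pow a b p e
  have hsub : ∀ a b : MvPolynomial (Fin 4) F, (a - b) ^ q = a ^ q - b ^ q := by
    intro a b
    rw [hq]
    exact sub_pow_char_pow a b e
  have hd2ne : d2 ≠ 0 := by
    intro h0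
    rw [hd2, hx1, hx2] at h0
    have h1 := congrArg
      (aeval (fun i : Fin 4 => if i = 0 then (Polynomial.X : Polynomial F) else 1)) h0
    simp at h1
    apply FiniteField.X_pow_card_sub_X_ne_zero F hq1
    rw [← neg_sub, h1, neg_zero]
  have hpow : d2 * d2 ^ (q - 1) = d2 ^ q := mul_pow_sub_one (by omega) d2
  have hd2q : d2 ^ q = x1 ^ q * x2 ^ q ^ 2 - x2 ^ q * x1 ^ q ^ 2 := by
    rw [hd2, hsub, mul_pow, mul_pow, ← pow_mul, ← pow_mul, sq]
  have hu0q : u0 ^ q = x1 ^ q * y1 ^ q + x2 ^ q * y2 ^ q := by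
    rw [hu0, hadd, mul_pow, mul_pow]
  have hu1q : u1 ^ q = x1 ^ q ^ 2 * y1 ^ q + x2 ^ q ^ 2 * y2 ^ q := by
    rw [hu1, hadd, mul_pow, mul_pow, ← pow_mul, ← pow_mul, sq]
  apply mul_left_cancel₀ hd2ne
  have key : d2 * (c0 * um1 - c1 * u0 ^ q + u1 ^ q)
      = d2 ^ q * um1 - d1 * u0 ^ q + d2 * u1 ^ q := by
    rw [← hpow, ← hc1, hc0]
    ring
  rw [key, hd2q, hu0q, hu1q, hd1, hum1, hd2]
  ring
end

section
/- In the polynomial ring R = F_q[x_1,x_2,y_1,y_2], the relation (T_1^*) holds: c_0^*·u_1 − c_1^*·u_0^q + u_{−1}^q = 0. -/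
open MvPolynomial

/-- Relation (T₁*): `c₀*·u₁ − c₁*·u₀^q + u₋₁^q = 0` in `F_q[x₁,x₂,y₁,y₂]`. -/
theorem stmt_2 (p e q : ℕ) (hp : p.Prime) (he : 1 ≤ e) (hq : q = p ^ e)
    (F : Type) [Field F] [Fintype F] (hF : Fintype.card F = q)
    (x1 x2 y1 y2 d1s d2s c0s c1s um1 u0 u1 : MvPolynomial (Fin 4) F)
    (hx1 : x1 = X 0) (hx2 : x2 = X 1) (hy1 : y1 = X 2) (hy2 : y2 = X 3)
    (hd2s : d2s = y2 * y1 ^ q - y1 * y2 ^ q)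
    (hd1s : d1s = y2 * y1 ^ q ^ 2 - y1 * y2 ^ q ^ 2)
    (hc0s : c0s = d2s ^ (q - 1))
    (hc1s : c1s * d2s = d1s)
    (hum1 : um1 = x1 * y1 ^ q + x2 * y2 ^ q)
    (hu0 : u0 = x1 * y1 + x2 * y2)
    (hu1 : u1 = x1 ^ q * y1 + x2 ^ q * y2) :
    c0s * u1 - c1s * u0 ^ q + um1 ^ q = 0 := by
  have : Fact p.Prime := ⟨hp⟩
  have hq1 : 1 < q := by rw [hq]; exact Nat.one_lt_pow (by omega) hp.one_lt
  have : CharP F p := charP_of_card_eq_prime_pow (hF.trans hq)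
  have hadd : ∀ a b : MvPolynomial (Fin 4) F, (a + b) ^ q = a ^ q + b ^ q := by
    intro a b; rw [hq]; exact add_pow_char_pow a b p e
  have hsub : ∀ a b : MvPolynomial (Fin 4) F, (a - b) ^ q = a ^ q - b ^ q := by
    intro a b; rw [hq]; exact sub_pow_char_pow a b e
  have hne : d2s ≠ 0 := by
    intro h
    have h2 := congrArg (MvPolynomial.aeval
      (![0, 0, Polynomial.X, 1] : Fin 4 → Polynomial F)) h
    rw [hd2s, hy1, hy2] at h2
    simp at h2
    exact FiniteField.X_pow_card_sub_X_ne_zero F hq1 h2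
  have hc0 : c0s * d2s = d2s ^ q := by
    rw [hc0s, ← pow_succ, Nat.sub_add_cancel hq1.le]
  have key : d2s ^ q * u1 - d1s * u0 ^ q + d2s * um1 ^ q = 0 := by
    rw [hd2s, hd1s, hu1, hu0, hum1, hadd, hadd, hsub]
    simp only [mul_pow, ← pow_mul, ← pow_two]
    ring
  apply mul_left_cancel₀ hne
  rw [mul_zero, ← key, ← hc0, ← hc1s]
  ring
end

section
/- In the polynomial ring R = F_q[x_1,x_2,y_1,y_2], the relation (T_00) holds: c_0·c_0^* − (u_{−1}·u_1 − u_0^{q+1})^{q−1} = 0. -/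
open MvPolynomial

/-- Relation (T₀₀): `c₀·c₀* − (u₋₁·u₁ − u₀^{q+1})^{q−1} = 0` in `F_q[x₁,x₂,y₁,y₂]`. -/
theorem stmt_5 (p e q : ℕ) (hp : p.Prime) (he : 1 ≤ e) (hq : q = p ^ e)
    (F : Type) [Field F] [Fintype F] (hF : Fintype.card F = q)
    (x1 x2 y1 y2 d2 d2s c0 c0s um1 u0 u1 : MvPolynomial (Fin 4) F)
    (hx1 : x1 = X 0) (hx2 : x2 = X 1) (hy1 : y1 = X 2) (hy2 : y2 = X 3)
    (hd2 : d2 = x1 * x2 ^ q - x2 * x1 ^ q)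
    (hd2s : d2s = y2 * y1 ^ q - y1 * y2 ^ q)
    (hc0 : c0 = d2 ^ (q - 1))
    (hc0s : c0s = d2s ^ (q - 1))
    (hum1 : um1 = x1 * y1 ^ q + x2 * y2 ^ q)
    (hu0 : u0 = x1 * y1 + x2 * y2)
    (hu1 : u1 = x1 ^ q * y1 + x2 ^ q * y2) :
    c0 * c0s - (um1 * u1 - u0 ^ (q + 1)) ^ (q - 1) = 0 := by
  haveI : Fact p.Prime := ⟨hp⟩
  haveI : CharP F p := charP_of_card_eq_prime_pow (f := e) (by rw [hF, hq])
  have hu : u0 ^ q = x1 ^ q * y1 ^ q + x2 ^ q * y2 ^ q := by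
    rw [hu0, hq, add_pow_char_pow, mul_pow, mul_pow]
  have key : um1 * u1 - u0 ^ (q + 1) = d2 * d2s := by
    rw [pow_succ, hu, hum1, hu1, hu0, hd2, hd2s]
    ring
  rw [key, hc0, hc0s, mul_pow, sub_self]
end

section
/- For every integer s with 1 ≤ s ≤ q−1, the identity (K_s) holds in R = F_q[x_1,x_2,y_1,y_2]: h_s·(d_2^*)^s = c_1^*·u_1^s + u_{−1}^{q−s}·u_0·Σ_{i=1}^{s} (−1)^i·binom(s,i)·(u_{−1}·u_1)^{s−i}·(u_0^{q+1})^{i−1}. -/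
open MvPolynomial Finset

/-- Identity (K_s): for `1 ≤ s ≤ q−1`,
`h_s·(d₂*)^s = c₁*·u₁^s + u₋₁^{q−s}·u₀·Σ_{i=1}^{s} (−1)^i·C(s,i)·(u₋₁·u₁)^{s−i}·(u₀^{q+1})^{i−1}`. -/
theorem stmt_6 (p e q : ℕ) (hp : p.Prime) (he : 1 ≤ e) (hq : q = p ^ e)
    (F : Type) [Field F] [Fintype F] (hF : Fintype.card F = q)
    (x1 x2 y1 y2 d2 d2s d1s c1s um1 u0 u1 : MvPolynomial (Fin 4) F)
    (hx1 : x1 = X 0) (hx2 : x2 = X 1) (hy1 : y1 = X 2) (hy2 : y2 = X 3)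
    (hd2 : d2 = x1 * x2 ^ q - x2 * x1 ^ q)
    (hd2s : d2s = y2 * y1 ^ q - y1 * y2 ^ q)
    (hd1s : d1s = y2 * y1 ^ q ^ 2 - y1 * y2 ^ q ^ 2)
    (hc1s : c1s * d2s = d1s)
    (hum1 : um1 = x1 * y1 ^ q + x2 * y2 ^ q)
    (hu0 : u0 = x1 * y1 + x2 * y2)
    (hu1 : u1 = x1 ^ q * y1 + x2 ^ q * y2)
    (h : ℕ → MvPolynomial (Fin 4) F)
    (hh : ∀ s : ℕ, s ≤ q - 1 →
      h s * u0 ^ q = u1 ^ (s + 1) * d2s ^ (q - 1 - s) + um1 ^ (q - s) * d2 ^ s) :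
    ∀ s : ℕ, 1 ≤ s → s ≤ q - 1 →
      h s * d2s ^ s = c1s * u1 ^ s +
        um1 ^ (q - s) * u0 * ∑ i ∈ Icc 1 s,
          (-1 : MvPolynomial (Fin 4) F) ^ i * (s.choose i : MvPolynomial (Fin 4) F) *
            (um1 * u1) ^ (s - i) * (u0 ^ (q + 1)) ^ (i - 1) := by
  have hq2 : 2 ≤ q := by
    rw [hq]
    calc 2 ≤ p := hp.two_le
      _ = p ^ 1 := (pow_one p).symm
      _ ≤ p ^ e := Nat.pow_le_pow_right hp.pos he
  have : Fact p.Prime := ⟨hp⟩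
  have hcF : CharP F p := by
    have h1 : ((p : ℕ) : F) = 0 := by
      have h2 : ((Fintype.card F : ℕ) : F) = 0 := Nat.cast_card_eq_zero F
      rw [hF, hq, Nat.cast_pow] at h2
      exact pow_eq_zero_iff (by omega) |>.1 h2
    exact (CharP.charP_iff_prime_eq_zero hp).2 h1
  have fadd : ∀ a b : MvPolynomial (Fin 4) F, (a + b) ^ q = a ^ q + b ^ q := by
    intro a b
    rw [hq]
    exact add_pow_char_pow a b p e
  have fsub : ∀ a b : MvPolynomial (Fin 4) F, (a - b) ^ q = a ^ q - b ^ q := by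
    intro a b
    rw [hq]
    exact sub_pow_char_pow a b e
  have hu0ne : u0 ≠ 0 := by
    intro h0
    have h1 := congrArg (MvPolynomial.eval (![1, 0, 1, 0] : Fin 4 → F)) h0
    rw [hu0, hx1, hx2, hy1, hy2] at h1
    simp at h1
  have hd2ne : d2s ≠ 0 := by
    intro h0
    have h1 := congrArg
      (MvPolynomial.aeval (![0, 0, 1, Polynomial.X] : Fin 4 → Polynomial F)) h0
    rw [hd2s, hy1, hy2] at h1
    simp at h1
    have h2 := congrArg Polynomial.natDegree (sub_eq_zero.1 h1)
    simp at h2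
    omega
  have hA : d2 * d2s = um1 * u1 - u0 ^ (q + 1) := by
    rw [pow_succ, hu0, fadd, hd2, hd2s, hum1, hu1]
    ring
  have hB : u1 * d2s ^ (q - 1) + um1 ^ q = c1s * u0 ^ q := by
    apply mul_right_cancel₀ hd2ne
    have e1 : d2s ^ (q - 1) * d2s = d2s ^ q := by
      rw [← pow_succ]; congr 1; omega
    have e2 : d2s ^ q = y2 ^ q * y1 ^ q ^ 2 - y1 ^ q * y2 ^ q ^ 2 := by
      rw [hd2s, fsub]; ring
    have e3 : um1 ^ q = x1 ^ q * y1 ^ q ^ 2 + x2 ^ q * y2 ^ q ^ 2 := by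
      rw [hum1, fadd]; ring
    have e4 : u0 ^ q = x1 ^ q * y1 ^ q + x2 ^ q * y2 ^ q := by
      rw [hu0, fadd]; ring
    calc (u1 * d2s ^ (q - 1) + um1 ^ q) * d2s
        = u1 * (d2s ^ (q - 1) * d2s) + um1 ^ q * d2s := by ring
      _ = d1s * u0 ^ q := by
        rw [e1, e2, e3, e4, hu1, hd2s, hd1s]; ring
      _ = c1s * u0 ^ q * d2s := by rw [← hc1s]; ring
  intro s hs1 hs
  apply mul_right_cancel₀ (pow_ne_zero q hu0ne)
  have hsum : (um1 * u1 - u0 ^ (q + 1)) ^ s = (um1 * u1) ^ s + u0 ^ (q + 1) *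
      ∑ i ∈ Icc 1 s, (-1 : MvPolynomial (Fin 4) F) ^ i * (s.choose i : MvPolynomial (Fin 4) F) *
            (um1 * u1) ^ (s - i) * (u0 ^ (q + 1)) ^ (i - 1) := by
    generalize um1 * u1 = a
    generalize u0 ^ (q + 1) = b
    rw [sub_eq_neg_add, add_pow, Finset.sum_range_succ', add_comm, Finset.mul_sum]
    congr 1
    · simp
    · rw [← Finset.Ico_add_one_right_eq_Icc, Finset.sum_Ico_eq_sum_range]
      apply Finset.sum_congr rfl
      intro i _
      rw [neg_pow, add_comm 1 i, Nat.add_sub_cancel]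
      ring
  have e5 : d2s ^ (q - 1 - s) * d2s ^ s = d2s ^ (q - 1) := by
    rw [← pow_add]; congr 1; omega
  have e6 : um1 ^ (q - s) * um1 ^ s = um1 ^ q := by
    rw [← pow_add]; congr 1; omega
  generalize (∑ i ∈ Icc 1 s, (-1 : MvPolynomial (Fin 4) F) ^ i *
    (s.choose i : MvPolynomial (Fin 4) F) *
            (um1 * u1) ^ (s - i) * (u0 ^ (q + 1)) ^ (i - 1)) = S at hsum ⊢
  calc h s * d2s ^ s * u0 ^ q = h s * u0 ^ q * d2s ^ s := by ring
    _ = u1 ^ (s + 1) * (d2s ^ (q - 1 - s) * d2s ^ s) + um1 ^ (q - s) * (d2 * d2s) ^ s := by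
      rw [hh s hs, mul_pow]; ring
    _ = u1 ^ s * (u1 * d2s ^ (q - 1) + um1 ^ (q - s) * um1 ^ s)
        + um1 ^ (q - s) * u0 ^ (q + 1) * S := by
      rw [e5, hA, hsum, mul_pow]; ring
    _ = _ := by
      rw [e6, hB]; ring
end

section
/- For every integer s with 1 ≤ s ≤ q−1, the identity (K_s^*) holds in R = F_q[x_1,x_2,y_1,y_2]: h_{q−1−s}·d_2^s = c_1·u_{−1}^s + u_0·u_1^{q−s}·Σ_{i=1}^{s} (−1)^i·binom(s,i)·(u_{−1}·u_1)^{s−i}·(u_0^{q+1})^{i−1}. -/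
open MvPolynomial Finset

theorem binom_aux {R : Type*} [CommRing R] (a b : R) (s : ℕ) :
    (a - b) ^ s = a ^ s + b * ∑ i ∈ Icc 1 s,
      (-1 : R) ^ i * (s.choose i : R) * a ^ (s - i) * b ^ (i - 1) := by
  rw [sub_eq_neg_add, add_pow, Finset.sum_range_succ', Finset.mul_sum,
    ← Finset.Ico_add_one_right_eq_Icc, Finset.sum_Ico_eq_sum_range, add_comm]
  congr 1
  · simp
  · apply Finset.sum_congr (by simp)
    intro i _
    rw [add_comm 1 i, Nat.add_sub_cancel, neg_pow, pow_succ b i]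
    ring

/-- Identity (K_s*): for `1 ≤ s ≤ q−1`,
`h_{q−1−s}·d₂^s = c₁·u₋₁^s + u₀·u₁^{q−s}·Σ_{i=1}^{s} (−1)^i·C(s,i)·(u₋₁·u₁)^{s−i}·(u₀^{q+1})^{i−1}`. -/
theorem stmt_7 (p e q : ℕ) (hp : p.Prime) (he : 1 ≤ e) (hq : q = p ^ e)
    (F : Type) [Field F] [Fintype F] (hF : Fintype.card F = q)
    (x1 x2 y1 y2 d1 d2 d2s c1 um1 u0 u1 : MvPolynomial (Fin 4) F)
    (hx1 : x1 = X 0) (hx2 : x2 = X 1) (hy1 : y1 = X 2) (hy2 : y2 = X 3)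
    (hd1 : d1 = x1 * x2 ^ q ^ 2 - x2 * x1 ^ q ^ 2)
    (hd2 : d2 = x1 * x2 ^ q - x2 * x1 ^ q)
    (hd2s : d2s = y2 * y1 ^ q - y1 * y2 ^ q)
    (hc1 : c1 * d2 = d1)
    (hum1 : um1 = x1 * y1 ^ q + x2 * y2 ^ q)
    (hu0 : u0 = x1 * y1 + x2 * y2)
    (hu1 : u1 = x1 ^ q * y1 + x2 ^ q * y2)
    (h : ℕ → MvPolynomial (Fin 4) F)
    (hh : ∀ s : ℕ, s ≤ q - 1 →
      h s * u0 ^ q = u1 ^ (s + 1) * d2s ^ (q - 1 - s) + um1 ^ (q - s) * d2 ^ s) :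
    ∀ s : ℕ, 1 ≤ s → s ≤ q - 1 →
      h (q - 1 - s) * d2 ^ s = c1 * um1 ^ s +
        u0 * u1 ^ (q - s) * ∑ i ∈ Icc 1 s,
          (-1 : MvPolynomial (Fin 4) F) ^ i * (s.choose i : MvPolynomial (Fin 4) F) *
            (um1 * u1) ^ (s - i) * (u0 ^ (q + 1)) ^ (i - 1) := by
  intro s hs1 hs
  have hq1 : 1 < q := by rw [← hF]; exact Fintype.one_lt_card
  have : Fact p.Prime := ⟨hp⟩
  have : CharP F p := by
    obtain ⟨r, hr⟩ := CharP.exists F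
    obtain ⟨n, hrp, hn⟩ := FiniteField.card F r
    have h1 : r ∣ p ^ e := by
      rw [← hq, ← hF, hn]
      exact dvd_pow_self r n.pos.ne'
    have h2 : r = p := (Nat.prime_dvd_prime_iff_eq hrp hp).1 (hrp.dvd_of_dvd_pow h1)
    rw [← h2]; exact hr
  have frob : ∀ a b : MvPolynomial (Fin 4) F, (a + b) ^ q = a ^ q + b ^ q := by
    intro a b; rw [hq]; exact add_pow_char_pow a b p e
  have frobs : ∀ a b : MvPolynomial (Fin 4) F, (a - b) ^ q = a ^ q - b ^ q := by
    intro a b; rw [hq]; exact sub_pow_char_pow a b e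
  have hu0ne : u0 ≠ 0 := by
    intro h0
    have := congrArg (MvPolynomial.eval (fun i : Fin 4 => if i = 0 ∨ i = 2 then (1 : F) else 0)) h0
    simp [hu0, hx1, hx2, hy1, hy2] at this
  have hd2ne : d2 ≠ 0 := by
    intro h0
    have := congrArg (MvPolynomial.aeval
      (fun i : Fin 4 => if i = 0 then (1 : Polynomial F) else Polynomial.X)) h0
    simp [hd2, hx1, hx2] at this
    exact FiniteField.X_pow_card_sub_X_ne_zero F hq1 this
  have hu0q : u0 ^ q = x1 ^ q * y1 ^ q + x2 ^ q * y2 ^ q := by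
    rw [hu0, frob, mul_pow, mul_pow]
  have hu1q : u1 ^ q = x1 ^ q ^ 2 * y1 ^ q + x2 ^ q ^ 2 * y2 ^ q := by
    rw [hu1, frob, mul_pow, mul_pow, ← pow_mul, ← pow_mul, sq]
  have hd2q : d2 ^ q = x1 ^ q * x2 ^ q ^ 2 - x2 ^ q * x1 ^ q ^ 2 := by
    rw [hd2, frobs, mul_pow, mul_pow, ← pow_mul, ← pow_mul, sq]
  have key : d2 * d2s = um1 * u1 - u0 ^ (q + 1) := by
    rw [pow_succ, hu0q, hd2, hd2s, hum1, hu1, hu0]; ring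
  have key2 : um1 * d2 ^ (q - 1) = c1 * u0 ^ q - u1 ^ q := by
    apply mul_right_cancel₀ hd2ne
    have e1 : um1 * d2 ^ (q - 1) * d2 = um1 * d2 ^ q := by
      rw [mul_assoc, ← pow_succ, Nat.sub_add_cancel hq1.le]
    have e2 : (c1 * u0 ^ q - u1 ^ q) * d2 = d1 * u0 ^ q - u1 ^ q * d2 := by
      rw [← hc1]; ring
    rw [e1, e2, hd2q, hu0q, hu1q, hd1, hd2, hum1]; ring
  have binom : (d2 * d2s) ^ s = (um1 * u1) ^ s + u0 ^ (q + 1) * ∑ i ∈ Icc 1 s,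
          (-1 : MvPolynomial (Fin 4) F) ^ i * (s.choose i : MvPolynomial (Fin 4) F) *
            (um1 * u1) ^ (s - i) * (u0 ^ (q + 1)) ^ (i - 1) := by
    rw [key]; exact binom_aux _ _ s
  apply mul_right_cancel₀ (pow_ne_zero q hu0ne)
  have hhs := hh (q - 1 - s) (by omega)
  rw [show q - 1 - s + 1 = q - s by omega, show q - 1 - (q - 1 - s) = s by omega,
    show q - (q - 1 - s) = s + 1 by omega] at hhs
  generalize (∑ i ∈ Icc 1 s,
          (-1 : MvPolynomial (Fin 4) F) ^ i * (s.choose i : MvPolynomial (Fin 4) F) *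
            (um1 * u1) ^ (s - i) * (u0 ^ (q + 1)) ^ (i - 1)) = S at binom ⊢
  have e3 : d2 ^ (q - 1 - s) * d2 ^ s = d2 ^ (q - 1) := by
    rw [← pow_add]; congr 1; omega
  have e4 : u1 ^ (q - s) * u1 ^ s = u1 ^ q := by
    rw [← pow_add]; congr 1; omega
  rw [mul_pow, mul_pow] at binom
  linear_combination d2 ^ s * hhs + u1 ^ (q - s) * binom + um1 ^ (s + 1) * e3
    + um1 ^ s * e4 + um1 ^ s * key2
end

section
/- The F_q-algebra involution * of R = F_q[x_1,x_2,y_1,y_2] determined by x_1 ↦ y_2, x_2 ↦ y_1, y_1 ↦ x_2, y_2 ↦ x_1 sends h_s to h_{q−1−s}; precisely, for 0 ≤ s ≤ q−1, if h_s·u_0^q = u_1^{s+1}·(d_2^*)^{q−1−s} + u_{−1}^{q−s}·d_2^s and h'·u_0^q = u_1^{q−s}·(d_2^*)^{s} + u_{−1}^{s+1}·d_2^{q−1−s}, then (h_s)^* = h'. -/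
open MvPolynomial

/-- The involution `*` of `F_q[x₁,x₂,y₁,y₂]` (determined by `x₁ ↦ y₂, x₂ ↦ y₁,
y₁ ↦ x₂, y₂ ↦ x₁`) sends `h_s` to `h_{q−1−s}`. -/
theorem stmt_8 (p e q : ℕ) (hp : p.Prime) (he : 1 ≤ e) (hq : q = p ^ e)
    (F : Type) [Field F] [Fintype F] (hF : Fintype.card F = q)
    (x1 x2 y1 y2 d2 d2s um1 u0 u1 : MvPolynomial (Fin 4) F)
    (hx1 : x1 = X 0) (hx2 : x2 = X 1) (hy1 : y1 = X 2) (hy2 : y2 = X 3)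
    (hd2 : d2 = x1 * x2 ^ q - x2 * x1 ^ q)
    (hd2s : d2s = y2 * y1 ^ q - y1 * y2 ^ q)
    (hum1 : um1 = x1 * y1 ^ q + x2 * y2 ^ q)
    (hu0 : u0 = x1 * y1 + x2 * y2)
    (hu1 : u1 = x1 ^ q * y1 + x2 ^ q * y2)
    (star : MvPolynomial (Fin 4) F →ₐ[F] MvPolynomial (Fin 4) F)
    (hstar : star = aeval ![y2, y1, x2, x1])
    (s : ℕ) (hs : s ≤ q - 1) (hs' hs'' : MvPolynomial (Fin 4) F)
    (hhs : hs' * u0 ^ q = u1 ^ (s + 1) * d2s ^ (q - 1 - s) + um1 ^ (q - s) * d2 ^ s)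
    (hhs' : hs'' * u0 ^ q = u1 ^ (q - s) * d2s ^ s + um1 ^ (s + 1) * d2 ^ (q - 1 - s)) :
    star hs' = hs'' := by
  have e1 : star x1 = y2 := by rw [hstar, hx1, aeval_X]; rfl
  have e2 : star x2 = y1 := by rw [hstar, hx2, aeval_X]; rfl
  have e3 : star y1 = x2 := by rw [hstar, hy1, aeval_X]; rfl
  have e4 : star y2 = x1 := by rw [hstar, hy2, aeval_X]; rfl
  have f1 : star d2 = d2s := by
    rw [hd2, hd2s]; simp only [map_sub, map_mul, map_pow, e1, e2]
  have f2 : star d2s = d2 := by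
    rw [hd2, hd2s]; simp only [map_sub, map_mul, map_pow, e3, e4]
  have f3 : star um1 = u1 := by
    rw [hum1, hu1]; simp only [map_add, map_mul, map_pow, e1, e2, e3, e4]; ring
  have f4 : star u1 = um1 := by
    rw [hum1, hu1]; simp only [map_add, map_mul, map_pow, e1, e2, e3, e4]; ring
  have f5 : star u0 = u0 := by
    rw [hu0]; simp only [map_add, map_mul, e1, e2, e3, e4]; ring
  have hne : u0 ≠ 0 := by
    intro h
    have h1 := congrArg (eval (![1, 0, 1, 0] : Fin 4 → F)) h
    rw [hu0, hx1, hx2, hy1, hy2] at h1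
    simp at h1
  have h := congrArg star hhs
  simp only [map_add, map_mul, map_pow, f1, f2, f3, f4, f5] at h
  apply mul_right_cancel₀ (pow_ne_zero q hne)
  rw [h, hhs', add_comm]
end

section
/- In the polynomial ring R = F_q[x_1,x_2,y_1,y_2], the relation (T_10) holds: c_1·c_0^* − c_1^*·u_1^{q−1} − u_{−1}·u_0·Σ_{i=1}^{q−1} (−1)^i·binom(q−1,i)·(u_{−1}·u_1)^{q−1−i}·u_0^{(q+1)(i−1)} = 0. -/
open MvPolynomial Finset

/-- The binomial sum, multiplied by `b`, is a difference of powers. -/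
theorem sum_aux {R : Type*} [CommRing R] (n : ℕ) (a b : R) :
    b * ∑ i ∈ Icc 1 n, (-1 : R) ^ i * (n.choose i : R) * a ^ (n - i) * b ^ (i - 1)
      = (a - b) ^ n - a ^ n := by
  have h : (a - b) ^ n = (-b + a) ^ n := by ring
  rw [h, add_pow, Finset.range_eq_Ico, Finset.sum_eq_sum_Ico_succ_bot (Nat.succ_pos n)]
  simp only [pow_zero, Nat.sub_zero, Nat.choose_zero_right, Nat.cast_one, one_mul, mul_one,
    add_sub_cancel_left]
  rw [Finset.mul_sum]
  have : Ico (0 + 1) (n + 1) = Icc 1 n := by ext; simp [Nat.succ_le_iff]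
  rw [this]
  refine Finset.sum_congr rfl fun i hi => ?_
  obtain ⟨j, rfl⟩ : ∃ j, i = j + 1 := ⟨i - 1, by have := (Finset.mem_Icc.1 hi).1; omega⟩
  rw [neg_pow b, Nat.add_sub_cancel]
  ring

/-- The key computation in a domain. -/
theorem key_aux {R : Type*} [CommRing R] [IsDomain R] (k : ℕ)
    (hadd : ∀ a b : R, (a + b) ^ (k + 1) = a ^ (k + 1) + b ^ (k + 1))
    (hsub : ∀ a b : R, (a - b) ^ (k + 1) = a ^ (k + 1) - b ^ (k + 1))
    (x1 x2 y1 y2 c1 c1s d ds um1 u0 u1 S : R)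
    (hd : d = x1 * x2 ^ (k + 1) - x2 * x1 ^ (k + 1))
    (hds : ds = y2 * y1 ^ (k + 1) - y1 * y2 ^ (k + 1))
    (hc1 : c1 * d = x1 * (x2 ^ (k + 1)) ^ (k + 1) - x2 * (x1 ^ (k + 1)) ^ (k + 1))
    (hc1s : c1s * ds = y2 * (y1 ^ (k + 1)) ^ (k + 1) - y1 * (y2 ^ (k + 1)) ^ (k + 1))
    (hum1 : um1 = x1 * y1 ^ (k + 1) + x2 * y2 ^ (k + 1))
    (hu0 : u0 = x1 * y1 + x2 * y2)
    (hu1 : u1 = x1 ^ (k + 1) * y1 + x2 ^ (k + 1) * y2)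
    (hS : u0 ^ (k + 2) * S = (um1 * u1 - u0 ^ (k + 2)) ^ k - (um1 * u1) ^ k)
    (hdn : d ≠ 0) (hdsn : ds ≠ 0) (hun : u0 ≠ 0) :
    c1 * ds ^ k - c1s * u1 ^ k - um1 * u0 * S = 0 := by
  have e0 : u0 ^ (k + 1) = x1 ^ (k + 1) * y1 ^ (k + 1) + x2 ^ (k + 1) * y2 ^ (k + 1) := by
    rw [hu0, hadd, mul_pow, mul_pow]
  have e1 : u1 ^ (k + 1) = (x1 ^ (k + 1)) ^ (k + 1) * y1 ^ (k + 1)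
      + (x2 ^ (k + 1)) ^ (k + 1) * y2 ^ (k + 1) := by
    rw [hu1, hadd, mul_pow, mul_pow]
  have em : um1 ^ (k + 1) = x1 ^ (k + 1) * (y1 ^ (k + 1)) ^ (k + 1)
      + x2 ^ (k + 1) * (y2 ^ (k + 1)) ^ (k + 1) := by
    rw [hum1, hadd, mul_pow, mul_pow]
  have ed : d ^ k * d = x1 ^ (k + 1) * (x2 ^ (k + 1)) ^ (k + 1)
      - x2 ^ (k + 1) * (x1 ^ (k + 1)) ^ (k + 1) := by
    rw [← pow_succ, hd, hsub, mul_pow, mul_pow]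
  have eds : ds ^ k * ds = y2 ^ (k + 1) * (y1 ^ (k + 1)) ^ (k + 1)
      - y1 ^ (k + 1) * (y2 ^ (k + 1)) ^ (k + 1) := by
    rw [← pow_succ, hds, hsub, mul_pow, mul_pow]
  have gram : um1 * u1 - u0 ^ (k + 2) = d * ds := by
    rw [show u0 ^ (k + 2) = u0 ^ (k + 1) * u0 from pow_succ _ _, e0, hum1, hu1, hu0, hd, hds]
    generalize x1 ^ (k + 1) = X1
    generalize x2 ^ (k + 1) = X2
    generalize y1 ^ (k + 1) = Y1
    generalize y2 ^ (k + 1) = Y2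
    ring
  have A : u0 ^ (k + 1) * c1 - um1 * d ^ k = u1 ^ (k + 1) := by
    apply mul_right_cancel₀ hdn
    have : (u0 ^ (k + 1) * c1 - um1 * d ^ k) * d
        = u0 ^ (k + 1) * (c1 * d) - um1 * (d ^ k * d) := by ring
    rw [this, hc1, ed, e0, e1, hum1, hd]
    generalize (x1 ^ (k + 1)) ^ (k + 1) = X1q
    generalize (x2 ^ (k + 1)) ^ (k + 1) = X2q
    generalize x1 ^ (k + 1) = X1
    generalize x2 ^ (k + 1) = X2
    generalize y1 ^ (k + 1) = Y1
    generalize y2 ^ (k + 1) = Y2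
    ring
  have B : u0 ^ (k + 1) * c1s - um1 ^ (k + 1) = ds ^ k * u1 := by
    apply mul_right_cancel₀ hdsn
    have : (u0 ^ (k + 1) * c1s - um1 ^ (k + 1)) * ds
        = u0 ^ (k + 1) * (c1s * ds) - um1 ^ (k + 1) * ds := by ring
    rw [this, hc1s, mul_right_comm, eds, e0, em, hu1, hds]
    generalize (y1 ^ (k + 1)) ^ (k + 1) = Y1q
    generalize (y2 ^ (k + 1)) ^ (k + 1) = Y2q
    generalize x1 ^ (k + 1) = X1
    generalize x2 ^ (k + 1) = X2
    generalize y1 ^ (k + 1) = Y1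
    generalize y2 ^ (k + 1) = Y2
    ring
  rw [gram, mul_pow, mul_pow] at hS
  apply mul_left_cancel₀ (pow_ne_zero (k + 1) hun)
  linear_combination (ds ^ k) * A - u1 ^ k * B - um1 * hS

/-- Relation (T₁₀):
`c₁·c₀* − c₁*·u₁^{q−1} − u₋₁·u₀·Σ_{i=1}^{q−1}(−1)^i·C(q−1,i)·(u₋₁·u₁)^{q−1−i}·u₀^{(q+1)(i−1)} = 0`. -/
theorem stmt_9 (p e q : ℕ) (hp : p.Prime) (he : 1 ≤ e) (hq : q = p ^ e)
    (F : Type) [Field F] [Fintype F] (hF : Fintype.card F = q)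
    (x1 x2 y1 y2 d1 d2 c1 d1s d2s c0s c1s um1 u0 u1 : MvPolynomial (Fin 4) F)
    (hx1 : x1 = X 0) (hx2 : x2 = X 1) (hy1 : y1 = X 2) (hy2 : y2 = X 3)
    (hd1 : d1 = x1 * x2 ^ q ^ 2 - x2 * x1 ^ q ^ 2)
    (hd2 : d2 = x1 * x2 ^ q - x2 * x1 ^ q)
    (hc1 : c1 * d2 = d1)
    (hd2s : d2s = y2 * y1 ^ q - y1 * y2 ^ q)
    (hd1s : d1s = y2 * y1 ^ q ^ 2 - y1 * y2 ^ q ^ 2)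
    (hc0s : c0s = d2s ^ (q - 1))
    (hc1s : c1s * d2s = d1s)
    (hum1 : um1 = x1 * y1 ^ q + x2 * y2 ^ q)
    (hu0 : u0 = x1 * y1 + x2 * y2)
    (hu1 : u1 = x1 ^ q * y1 + x2 ^ q * y2) :
    c1 * c0s - c1s * u1 ^ (q - 1) -
      um1 * u0 * ∑ i ∈ Icc 1 (q - 1),
        (-1 : MvPolynomial (Fin 4) F) ^ i * ((q - 1).choose i : MvPolynomial (Fin 4) F) *
          (um1 * u1) ^ (q - 1 - i) * u0 ^ ((q + 1) * (i - 1)) = 0 := by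
  subst hq
  have : Fact p.Prime := ⟨hp⟩
  have : CharP F p := charP_of_card_eq_prime_pow (f := e) hF
  have hadd : ∀ a b : MvPolynomial (Fin 4) F, (a + b) ^ p ^ e = a ^ p ^ e + b ^ p ^ e :=
    fun a b => add_pow_char_pow a b p e
  have hsub : ∀ a b : MvPolynomial (Fin 4) F, (a - b) ^ p ^ e = a ^ p ^ e - b ^ p ^ e :=
    fun a b => sub_pow_char_pow a b e
  have hX : (Polynomial.X ^ p ^ e - Polynomial.X : Polynomial F) ≠ 0 :=
    FiniteField.X_pow_card_sub_X_ne_zero F (Nat.one_lt_pow (by omega) hp.one_lt)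
  have hd2n : d2 ≠ 0 := by
    intro h
    apply hX
    have := congrArg (aeval (![1, Polynomial.X, 1, 1] : Fin 4 → Polynomial F)) h
    simpa [hd2, hx1, hx2] using this
  have hd2sn : d2s ≠ 0 := by
    intro h
    apply hX
    have := congrArg (aeval (![1, 1, Polynomial.X, 1] : Fin 4 → Polynomial F)) h
    simpa [hd2s, hy1, hy2] using this
  have hu0n : u0 ≠ 0 := by
    intro h
    have := congrArg (aeval (![1, 0, 1, 0] : Fin 4 → F)) h
    simp [hu0, hx1, hx2, hy1, hy2] at this
  obtain ⟨k, hk⟩ : ∃ k, p ^ e = k + 1 := ⟨p ^ e - 1, by have := pow_pos hp.pos e; omega⟩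
  clear hX this
  simp only [hk] at hadd hsub hd1 hd2 hd1s hd2s hc0s hum1 hu1 ⊢
  simp only [pow_two, pow_mul, Nat.add_sub_cancel] at hd1 hd1s hc0s ⊢
  rw [hc0s]
  refine key_aux k hadd hsub x1 x2 y1 y2 c1 c1s d2 d2s um1 u0 u1 _ hd2 hd2s
    (hc1.trans hd1) (hc1s.trans hd1s) hum1 hu0 hu1 ?_ hd2n hd2sn hu0n
  exact sum_aux k (um1 * u1) (u0 ^ (k + 2))
end

section
/- In the polynomial ring R = F_q[x_1,x_2,y_1,y_2], the relation (T_01) holds: c_0·c_1^* − c_1·u_{−1}^{q−1} − u_0·u_1·Σ_{i=1}^{q−1} (−1)^i·binom(q−1,i)·(u_{−1}·u_1)^{q−1−i}·u_0^{(q+1)(i−1)} = 0. -/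
open MvPolynomial Finset

lemma T01_aux {R : Type*} [CommRing R] (n : ℕ)
    (hadd : ∀ a b : R, (a + b) ^ (n + 1) = a ^ (n + 1) + b ^ (n + 1))
    (hsub : ∀ a b : R, (a - b) ^ (n + 1) = a ^ (n + 1) - b ^ (n + 1))
    (x1 x2 y1 y2 d1 d2 c1 d1s d2s c1s a u b S : R)
    (hd1 : d1 = x1 * x2 ^ (n + 1) ^ 2 - x2 * x1 ^ (n + 1) ^ 2)
    (hd2 : d2 = x1 * x2 ^ (n + 1) - x2 * x1 ^ (n + 1))
    (hc1 : c1 * d2 = d1)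
    (hd2s : d2s = y2 * y1 ^ (n + 1) - y1 * y2 ^ (n + 1))
    (hd1s : d1s = y2 * y1 ^ (n + 1) ^ 2 - y1 * y2 ^ (n + 1) ^ 2)
    (hc1s : c1s * d2s = d1s)
    (ha : a = x1 * y1 ^ (n + 1) + x2 * y2 ^ (n + 1))
    (hu : u = x1 * y1 + x2 * y2)
    (hb : b = x1 ^ (n + 1) * y1 + x2 ^ (n + 1) * y2)
    (hS : (a * b - u ^ (n + 2)) ^ n = (a * b) ^ n + u ^ (n + 2) * S) :
    u ^ (n + 1) * d2 * d2s * (d2 ^ n * c1s - c1 * a ^ n - u * b * S) = 0 := by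
  have huq : u ^ (n + 1) = x1 ^ (n + 1) * y1 ^ (n + 1) + x2 ^ (n + 1) * y2 ^ (n + 1) := by
    rw [hu, hadd, mul_pow, mul_pow]
  have hdd : d2 * d2s = a * b - u ^ (n + 2) := by
    rw [pow_succ u (n + 1), huq, hd2, hd2s, ha, hb, hu]; ring
  have haq : a ^ (n + 1) = x1 ^ (n + 1) * y1 ^ (n + 1) ^ 2 + x2 ^ (n + 1) * y2 ^ (n + 1) ^ 2 := by
    rw [ha, hadd, mul_pow, mul_pow, ← pow_mul, ← pow_mul, sq]
  have hbq : b ^ (n + 1) = x1 ^ (n + 1) ^ 2 * y1 ^ (n + 1) + x2 ^ (n + 1) ^ 2 * y2 ^ (n + 1) := by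
    rw [hb, hadd, mul_pow, mul_pow, ← pow_mul, ← pow_mul, sq]
  have huqq : (u ^ (n + 1)) ^ (n + 1)
      = x1 ^ (n + 1) ^ 2 * y1 ^ (n + 1) ^ 2 + x2 ^ (n + 1) ^ 2 * y2 ^ (n + 1) ^ 2 := by
    rw [huq, hadd, mul_pow, mul_pow, ← pow_mul, ← pow_mul, ← pow_mul, ← pow_mul, sq]
  have hd2q : d2 ^ (n + 1) = x1 ^ (n + 1) * x2 ^ (n + 1) ^ 2 - x2 ^ (n + 1) * x1 ^ (n + 1) ^ 2 := by
    rw [hd2, hsub, mul_pow, mul_pow, ← pow_mul, ← pow_mul, sq]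
  have h1 : d2 ^ (n + 1) * d1s = a ^ (n + 1) * (x1 ^ (n + 1) ^ 2 * y1 + x2 ^ (n + 1) ^ 2 * y2)
      - b * (u ^ (n + 1)) ^ (n + 1) := by
    rw [huqq, hd2q, hd1s, haq, hb]; ring
  have h2 : d1 * d2s = a * (x1 ^ (n + 1) ^ 2 * y1 + x2 ^ (n + 1) ^ 2 * y2) - u * b ^ (n + 1) := by
    rw [hbq, hd1, hd2s, ha, hu]; ring
  have h3 : (d2 * d2s) ^ (n + 1)
      = a ^ (n + 1) * b ^ (n + 1) - u ^ (n + 1) * (u ^ (n + 1)) ^ (n + 1) := by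
    rw [hdd, hsub, mul_pow, pow_succ u (n + 1), mul_pow]; ring
  rw [← hdd] at hS
  have h4 : (d2 * d2s) ^ (n + 1) = d2 * d2s * (a ^ n * b ^ n + u ^ (n + 2) * S) := by
    rw [pow_succ', hS, mul_pow]
  generalize x1 ^ (n + 1) ^ 2 * y1 + x2 ^ (n + 1) ^ 2 * y2 = w at h1 h2
  generalize (u ^ (n + 1)) ^ (n + 1) = v at h1 h3
  have e1 : u ^ (n + 1) * d2 * d2s * (d2 ^ n * c1s - c1 * a ^ n - u * b * S)
      = u ^ (n + 1) * (d2 ^ (n + 1) * d1s) - u ^ (n + 1) * a ^ n * (d1 * d2s)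
        - b * ((d2 * d2s) ^ (n + 1) - d2 * d2s * a ^ n * b ^ n) := by
    rw [h4, ← hc1, ← hc1s]; ring
  rw [e1, h1, h2, h3, hdd]; ring

/-- Relation (T₀₁):
`c₀·c₁* − c₁·u₋₁^{q−1} − u₀·u₁·Σ_{i=1}^{q−1}(−1)^i·C(q−1,i)·(u₋₁·u₁)^{q−1−i}·u₀^{(q+1)(i−1)} = 0`. -/
theorem stmt_10 (p e q : ℕ) (hp : p.Prime) (he : 1 ≤ e) (hq : q = p ^ e)
    (F : Type) [Field F] [Fintype F] (hF : Fintype.card F = q)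
    (x1 x2 y1 y2 d1 d2 c0 c1 d1s d2s c1s um1 u0 u1 : MvPolynomial (Fin 4) F)
    (hx1 : x1 = X 0) (hx2 : x2 = X 1) (hy1 : y1 = X 2) (hy2 : y2 = X 3)
    (hd1 : d1 = x1 * x2 ^ q ^ 2 - x2 * x1 ^ q ^ 2)
    (hd2 : d2 = x1 * x2 ^ q - x2 * x1 ^ q)
    (hc0 : c0 = d2 ^ (q - 1))
    (hc1 : c1 * d2 = d1)
    (hd2s : d2s = y2 * y1 ^ q - y1 * y2 ^ q)
    (hd1s : d1s = y2 * y1 ^ q ^ 2 - y1 * y2 ^ q ^ 2)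
    (hc1s : c1s * d2s = d1s)
    (hum1 : um1 = x1 * y1 ^ q + x2 * y2 ^ q)
    (hu0 : u0 = x1 * y1 + x2 * y2)
    (hu1 : u1 = x1 ^ q * y1 + x2 ^ q * y2) :
    c0 * c1s - c1 * um1 ^ (q - 1) -
      u0 * u1 * ∑ i ∈ Icc 1 (q - 1),
        (-1 : MvPolynomial (Fin 4) F) ^ i * ((q - 1).choose i : MvPolynomial (Fin 4) F) *
          (um1 * u1) ^ (q - 1 - i) * u0 ^ ((q + 1) * (i - 1)) = 0 := by
  obtain ⟨n, rfl⟩ : ∃ n, q = n + 1 :=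
    ⟨q - 1, by have := Fintype.card_pos (α := F); omega⟩
  have : Fact p.Prime := ⟨hp⟩
  have : CharP F p := charP_of_card_eq_prime_pow (f := e) (by rw [hF, hq])
  have hadd : ∀ a b : MvPolynomial (Fin 4) F,
      (a + b) ^ (n + 1) = a ^ (n + 1) + b ^ (n + 1) := by
    intro a b; rw [hq]; exact add_pow_char_pow a b p e
  have hsub : ∀ a b : MvPolynomial (Fin 4) F,
      (a - b) ^ (n + 1) = a ^ (n + 1) - b ^ (n + 1) := by
    intro a b; rw [hq]; exact sub_pow_char_pow a b e
  have hne : (Polynomial.X ^ (n + 1) - Polynomial.X : Polynomial F) ≠ 0 := by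
    rw [← hF]
    exact FiniteField.X_pow_card_sub_X_ne_zero F Fintype.one_lt_card
  have hd2n : d2 ≠ 0 := by
    intro h
    apply hne
    have := congrArg (aeval ![(1 : Polynomial F), Polynomial.X, 0, 0]) (hd2.symm.trans h)
    simpa [hx1, hx2] using this
  have hd2sn : d2s ≠ 0 := by
    intro h
    apply hne
    have := congrArg (aeval ![(0 : Polynomial F), 0, Polynomial.X, 1]) (hd2s.symm.trans h)
    simpa [hy1, hy2] using this
  have hun : u0 ≠ 0 := by
    intro h
    have := congrArg (eval ![(1 : F), 0, 1, 0]) (hu0.symm.trans h)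
    simp [hx1, hx2, hy1, hy2] at this
  simp only [Nat.add_sub_cancel] at *
  generalize hSd : (∑ i ∈ Icc 1 n,
        (-1 : MvPolynomial (Fin 4) F) ^ i * (n.choose i : MvPolynomial (Fin 4) F) *
          (um1 * u1) ^ (n - i) * u0 ^ ((n + 1 + 1) * (i - 1))) = S
  have hS : (um1 * u1 - u0 ^ (n + 2)) ^ n = (um1 * u1) ^ n + u0 ^ (n + 2) * S := by
    rw [sub_eq_neg_add, add_pow, Finset.sum_range_succ', ← hSd, Finset.mul_sum,
      Finset.range_eq_Ico, Finset.sum_Ico_add' (fun m => (-u0 ^ (n + 2)) ^ m * (um1 * u1) ^ (n - m) * (n.choose m : MvPolynomial (Fin 4) F)) 0 n 1, add_comm]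
    congr 1
    · simp
    · refine Finset.sum_congr (by ext i; simp <;> omega) ?_
      intro i hi
      obtain ⟨j, rfl⟩ : ∃ j, i = j + 1 := ⟨i - 1, by have := (Finset.mem_Icc.mp hi).1; omega⟩
      rw [neg_pow, ← pow_mul, Nat.add_sub_cancel]
      ring
  have key := T01_aux n hadd hsub x1 x2 y1 y2 d1 d2 c1 d1s d2s c1s um1 u0 u1 S hd1 hd2 hc1
    hd2s hd1s hc1s hum1 hu0 hu1 hS
  rw [hc0]
  exact (mul_eq_zero.mp key).resolve_left
    (mul_ne_zero (mul_ne_zero (pow_ne_zero _ hun) hd2n) hd2sn)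
end

section
/- The five relation polynomials T_1, T_1^*, T_00, T_10, T_01 all lie in the kernel of π; that is, the ideal I of S they generate satisfies I ⊆ ker(π). -/
open MvPolynomial Finset

lemma aux_sum {R : Type*} [CommRing R] (n : ℕ) (P u : R) (m : ℕ) :
    u ^ m * (∑ i ∈ Icc 1 n, (-1 : R) ^ i * (n.choose i : R) * P ^ (n - i) * u ^ (m * (i - 1)))
      = (P - u ^ m) ^ n - P ^ n := by
  have h : (P - u ^ m) ^ n = ∑ i ∈ range (n + 1),
      (-1 : R) ^ i * (n.choose i : R) * P ^ (n - i) * u ^ (m * i) := by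
    rw [show P - u ^ m = -u ^ m + P by ring, add_pow]
    refine Finset.sum_congr rfl fun i _ => ?_
    rw [neg_pow, ← pow_mul]; ring
  have h2 : Icc 1 n = (range n).image (· + 1) := by
    ext i
    simp only [Finset.mem_Icc, Finset.mem_image, Finset.mem_range]
    constructor
    · intro hi
      exact ⟨i - 1, by omega, by omega⟩
    · rintro ⟨j, hj, rfl⟩
      omega
  rw [h, Finset.sum_range_succ', Finset.mul_sum, h2,
    Finset.sum_image (fun a _ b _ hab => by simpa using hab)]
  simp only [pow_zero, Nat.choose_zero_right, Nat.cast_one, Nat.sub_zero, mul_zero, mul_one,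
    one_mul, add_sub_cancel_right]
  refine Finset.sum_congr rfl fun i _ => ?_
  rw [Nat.mul_succ, pow_add, Nat.add_sub_cancel]; ring

lemma aux_rel {R : Type*} [CommRing R] [IsDomain R] (q : ℕ) (hq : 1 ≤ q)
    (c0 c1 c0s c1s um1 u0 u1 : R) (h0 : u0 ≠ 0)
    (h1 : c0 * um1 - c1 * u0 ^ q + u1 ^ q = 0)
    (h2 : c0s * u1 - c1s * u0 ^ q + um1 ^ q = 0)
    (h3 : c0 * c0s - (um1 * u1 - u0 ^ (q + 1)) ^ (q - 1) = 0) :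
    c1 * c0s - c1s * u1 ^ (q - 1) - um1 * u0 * ∑ i ∈ Icc 1 (q - 1),
        (-1 : R) ^ i * ((q - 1).choose i : R) *
          (um1 * u1) ^ (q - 1 - i) * u0 ^ ((q + 1) * (i - 1)) = 0 := by
  have hs := aux_sum (q - 1) (um1 * u1) u0 (q + 1)
  refine (mul_eq_zero.mp ?_).resolve_left (pow_ne_zero q h0)
  generalize (∑ i ∈ Icc 1 (q - 1), (-1 : R) ^ i * ((q - 1).choose i : R) *
          (um1 * u1) ^ (q - 1 - i) * u0 ^ ((q + 1) * (i - 1))) = S at hs ⊢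
  obtain ⟨r, rfl⟩ : ∃ r, q = r + 1 := ⟨q - 1, by omega⟩
  simp only [Nat.add_sub_cancel] at *
  rw [mul_pow um1 u1] at hs
  rw [pow_succ u0 (r + 1)] at *
  linear_combination (-c0s) * h1 + u1 ^ r * h2 - um1 * hs + um1 * h3

/-- The five relation polynomials `T₁, T₁*, T₀₀, T₁₀, T₀₁` lie in the kernel of `π`,
i.e. the ideal `I` they generate satisfies `I ⊆ ker π`. -/
theorem stmt_11 (p e q : ℕ) (hp : p.Prime) (he : 1 ≤ e) (hq : q = p ^ e)
    (F : Type) [Field F] [Fintype F] (hF : Fintype.card F = q)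
    (x1 x2 y1 y2 d1 d2 c0 c1 d1s d2s c0s c1s um1 u0 u1 : MvPolynomial (Fin 4) F)
    (hx1 : x1 = X 0) (hx2 : x2 = X 1) (hy1 : y1 = X 2) (hy2 : y2 = X 3)
    (hd1 : d1 = x1 * x2 ^ q ^ 2 - x2 * x1 ^ q ^ 2)
    (hd2 : d2 = x1 * x2 ^ q - x2 * x1 ^ q)
    (hc0 : c0 = d2 ^ (q - 1))
    (hc1 : c1 * d2 = d1)
    (hd2s : d2s = y2 * y1 ^ q - y1 * y2 ^ q)
    (hd1s : d1s = y2 * y1 ^ q ^ 2 - y1 * y2 ^ q ^ 2)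
    (hc0s : c0s = d2s ^ (q - 1))
    (hc1s : c1s * d2s = d1s)
    (hum1 : um1 = x1 * y1 ^ q + x2 * y2 ^ q)
    (hu0 : u0 = x1 * y1 + x2 * y2)
    (hu1 : u1 = x1 ^ q * y1 + x2 ^ q * y2)
    (π : MvPolynomial (Fin 7) F →ₐ[F] MvPolynomial (Fin 4) F)
    (hπ : π = aeval ![c0, c1, c0s, c1s, um1, u0, u1])
    (T1 T1s T00 T10 T01 : MvPolynomial (Fin 7) F)
    (hT1 : T1 = X 0 * X 4 - X 1 * X 5 ^ q + X 6 ^ q)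
    (hT1s : T1s = X 2 * X 6 - X 3 * X 5 ^ q + X 4 ^ q)
    (hT00 : T00 = X 0 * X 2 - (X 4 * X 6 - X 5 ^ (q + 1)) ^ (q - 1))
    (hT10 : T10 = X 1 * X 2 - X 3 * X 6 ^ (q - 1) -
      X 4 * X 5 * ∑ i ∈ Icc 1 (q - 1),
        (-1 : MvPolynomial (Fin 7) F) ^ i * ((q - 1).choose i : MvPolynomial (Fin 7) F) *
          (X 4 * X 6) ^ (q - 1 - i) * X 5 ^ ((q + 1) * (i - 1)))
    (hT01 : T01 = X 0 * X 3 - X 1 * X 4 ^ (q - 1) -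
      X 5 * X 6 * ∑ i ∈ Icc 1 (q - 1),
        (-1 : MvPolynomial (Fin 7) F) ^ i * ((q - 1).choose i : MvPolynomial (Fin 7) F) *
          (X 4 * X 6) ^ (q - 1 - i) * X 5 ^ ((q + 1) * (i - 1)))
    (I : Ideal (MvPolynomial (Fin 7) F))
    (hI : I = Ideal.span {T1, T1s, T00, T10, T01}) :
    I ≤ RingHom.ker π := by
  have hq1 : 1 ≤ q := hq ▸ Nat.one_le_pow _ _ hp.pos
  have : Fact p.Prime := ⟨hp⟩
  have : CharP F p := by
    obtain ⟨p', hp'⟩ := CharP.exists F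
    obtain ⟨n, hpr, hn⟩ := FiniteField.card F p'
    have : p' ∣ p ^ e := by
      rw [← hq, ← hF, hn]; exact dvd_pow_self _ n.ne_zero
    rwa [(Nat.prime_dvd_prime_iff_eq hpr hp).mp (hpr.dvd_of_dvd_pow this)] at hp'
  have fa : ∀ a b : MvPolynomial (Fin 4) F, (a + b) ^ q = a ^ q + b ^ q := fun a b => by
    rw [hq]; exact add_pow_char_pow ..
  have fs : ∀ a b : MvPolynomial (Fin 4) F, (a - b) ^ q = a ^ q - b ^ q := fun a b => by
    rw [hq]; exact sub_pow_char_pow ..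
  have hne : (Polynomial.X ^ q - Polynomial.X : Polynomial F) ≠ 0 :=
    hF ▸ FiniteField.X_pow_card_sub_X_ne_zero F Fintype.one_lt_card
  have n2 : d2 ≠ 0 := by
    intro h
    apply hne
    have := congrArg (aeval ![1, (Polynomial.X : Polynomial F), 0, 0]) h
    simpa [hd2, hx1, hx2] using this
  have n2s : d2s ≠ 0 := by
    intro h
    apply hne
    have := congrArg (aeval ![0, 0, (Polynomial.X : Polynomial F), 1]) h
    simpa [hd2s, hy1, hy2] using this
  have n0 : u0 ≠ 0 := by
    intro h
    have := congrArg (aeval ![(1 : F), 0, 1, 0]) h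
    simp [hu0, hx1, hx2, hy1, hy2] at this
  clear hx1 hx2 hy1 hy2
  have p2 : d2 ^ (q - 1) * d2 = d2 ^ q := by rw [← pow_succ, Nat.sub_add_cancel hq1]
  have p2s : d2s ^ (q - 1) * d2s = d2s ^ q := by rw [← pow_succ, Nat.sub_add_cancel hq1]
  rw [← hc0] at p2
  rw [← hc0s] at p2s
  have u0q : u0 ^ q = x1 ^ q * y1 ^ q + x2 ^ q * y2 ^ q := by rw [hu0, fa, mul_pow, mul_pow]
  have u1q : u1 ^ q = x1 ^ q ^ 2 * y1 ^ q + x2 ^ q ^ 2 * y2 ^ q := by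
    rw [hu1, fa, mul_pow, mul_pow, ← pow_mul, ← pow_mul, ← sq]
  have um1q : um1 ^ q = x1 ^ q * y1 ^ q ^ 2 + x2 ^ q * y2 ^ q ^ 2 := by
    rw [hum1, fa, mul_pow, mul_pow, ← pow_mul, ← pow_mul, ← sq]
  have d2q : d2 ^ q = x1 ^ q * x2 ^ q ^ 2 - x2 ^ q * x1 ^ q ^ 2 := by
    rw [hd2, fs, mul_pow, mul_pow, ← pow_mul, ← pow_mul, ← sq]
  have d2sq : d2s ^ q = y2 ^ q * y1 ^ q ^ 2 - y1 ^ q * y2 ^ q ^ 2 := by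
    rw [hd2s, fs, mul_pow, mul_pow, ← pow_mul, ← pow_mul, ← sq]
  have h1 : c0 * um1 - c1 * u0 ^ q + u1 ^ q = 0 := by
    refine (mul_eq_zero.mp ?_).resolve_left n2
    have : d2 ^ q * um1 - d1 * u0 ^ q + d2 * u1 ^ q = 0 := by
      rw [d2q, u0q, u1q, hum1, hd1, hd2]; ring
    linear_combination this + um1 * p2 - u0 ^ q * hc1
  have h2 : c0s * u1 - c1s * u0 ^ q + um1 ^ q = 0 := by
    refine (mul_eq_zero.mp ?_).resolve_left n2s
    have : d2s ^ q * u1 - d1s * u0 ^ q + d2s * um1 ^ q = 0 := by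
      rw [d2sq, u0q, um1q, hu1, hd1s, hd2s]; ring
    linear_combination this + u1 * p2s - u0 ^ q * hc1s
  have h3 : c0 * c0s - (um1 * u1 - u0 ^ (q + 1)) ^ (q - 1) = 0 := by
    rw [hc0, hc0s, ← mul_pow, sub_eq_zero]
    congr 1
    rw [pow_succ, u0q, hum1, hu1, hu0, hd2, hd2s]; ring
  have h4 := aux_rel q hq1 c0 c1 c0s c1s um1 u0 u1 n0 h1 h2 h3
  have h5 := aux_rel q hq1 c0s c1s c0 c1 u1 u0 um1 n0 h2 h1
    (by rw [mul_comm c0s, mul_comm u1]; exact h3)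
  rw [mul_comm u1 um1, mul_comm c1s, mul_comm u1 u0] at h5
  rw [hI, Ideal.span_le]
  rintro t (rfl | rfl | rfl | rfl | rfl) <;> rw [SetLike.mem_coe, RingHom.mem_ker, hπ]
  · rw [hT1]; simpa using h1
  · rw [hT1s]; simpa using h2
  · rw [hT00]; simpa using h3
  · rw [hT10]
    simp only [map_sub, map_mul, map_sum, map_pow, map_neg, map_one, map_natCast, aeval_X]
    exact h4
  · rw [hT01]
    simp only [map_sub, map_mul, map_sum, map_pow, map_neg, map_one, map_natCast, aeval_X]
    exact h5
end

section
/- Main Theorem: the kernel of π equals I, i.e. every algebraic relation among the seven generators c_0, c_1, c_0^*, c_1^*, u_{−1}, u_0, u_1 of the invariant ring F_q[V⊕V^*]^{GL_2(F_q)} is generated by the five relations T_1, T_1^*, T_00, T_10, T_01: ker(π) = I. -/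
open MvPolynomial Finset

lemma aux_sum_s12 {B : Type*} [CommRing B] (k : ℕ) (x v : B) :
    ∑ i ∈ Icc 1 (k + 1), (-1 : B) ^ i * ((k + 1).choose i : B) * x ^ (k + 1 - i) *
        v ^ ((k + 2 + 1) * (i - 1)) =
      ∑ j ∈ range k, (-1 : B) ^ (j + 1) * ((k + 1).choose (j + 1) : B) * x ^ (k - j) *
        v ^ ((k + 3) * j) + (-1) ^ (k + 1) * v ^ ((k + 3) * k) := by
  have h : Icc 1 (k + 1) = Ico 1 (k + 2) := by ext; simp; omega
  rw [h, Finset.sum_Ico_eq_sum_range]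
  rw [show k + 2 - 1 = k + 1 by omega, Finset.sum_range_succ]
  congr 1
  · refine Finset.sum_congr rfl fun j _ => ?_
    rw [show 1 + j = j + 1 by omega, show k + 1 - (j + 1) = k - j by omega,
      show j + 1 - 1 = j by omega]
  · rw [show 1 + k = k + 1 by omega]; simp

lemma aux_binom {B : Type*} [CommRing B] (k : ℕ) (x v : B) :
    (x - v ^ (k + 2 + 1)) ^ (k + 1) = x ^ (k + 1) + v ^ (k + 3) *
    ∑ i ∈ Icc 1 (k + 1), (-1 : B) ^ i * ((k + 1).choose i : B) * x ^ (k + 1 - i) *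
        v ^ ((k + 2 + 1) * (i - 1)) := by
  have h : Icc 1 (k + 1) = Ico 1 (k + 2) := by ext; simp; omega
  rw [h, Finset.sum_Ico_eq_sum_range, sub_eq_add_neg, add_comm x, add_pow,
    Finset.sum_range_succ', add_comm, Finset.mul_sum]
  rw [show k + 2 - 1 = k + 1 by omega]
  congr 1
  · simp
  · refine Finset.sum_congr rfl fun j _ => ?_
    rw [show 1 + j = j + 1 by omega, show j + 1 - 1 = j by omega, neg_pow (v ^ _)]
    rw [← pow_mul]
    ring

/-- Normal exponents. -/
def nrm (k : ℕ) : Finset (ℕ × ℕ × ℕ) :=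
  (range (k + 2) ×ˢ range ((k + 3) * k + 1) ×ˢ range (k + 2)) ∪
    (range (k + 2)).image fun j => (0, (k + 3) * k + 1 + j, 0)

lemma card_nrm (k : ℕ) : (nrm k).card ≤ ((k + 2) ^ 2 - 1) * ((k + 2) ^ 2 - (k + 2)) := by
  refine (Finset.card_union_le _ _).trans ?_
  refine (add_le_add le_rfl Finset.card_image_le).trans ?_
  simp only [card_product, card_range]
  have h1 : (k + 2) ^ 2 - 1 = (k + 3) * (k + 1) := by
    rw [Nat.sub_eq_iff_eq_add (by have := Nat.one_le_pow 2 (k + 2) (by omega); nlinarith)]; ring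
  have h2 : (k + 2) ^ 2 - (k + 2) = (k + 2) * (k + 1) := by
    rw [Nat.sub_eq_iff_eq_add (by have := Nat.one_le_pow 2 (k + 2) (by omega); nlinarith)]; ring
  rw [h1, h2]
  apply le_of_eq; ring

lemma mon_mem {A B : Type*} [CommRing A] [CommRing B] [Algebra A B] (k : ℕ)
    (c0 c1 d0 d1 : A) (u v w s : B)
    (hs : s = ∑ i ∈ Icc 1 (k + 1), (-1 : B) ^ i * ((k + 1).choose i : B) * (u * w) ^ (k + 1 - i) *
        v ^ ((k + 2 + 1) * (i - 1)))
    (h1 : algebraMap A B c0 * u - algebraMap A B c1 * v ^ (k + 2) + w ^ (k + 2) = 0)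
    (h2 : algebraMap A B d0 * w - algebraMap A B d1 * v ^ (k + 2) + u ^ (k + 2) = 0)
    (h3 : algebraMap A B c0 * algebraMap A B d0 - (u * w - v ^ (k + 2 + 1)) ^ (k + 1) = 0)
    (h4 : algebraMap A B c1 * algebraMap A B d0 - algebraMap A B d1 * w ^ (k + 1) - u * v * s = 0)
    (h5 : algebraMap A B c0 * algebraMap A B d1 - algebraMap A B c1 * u ^ (k + 1) - v * w * s = 0)
    (n : ℕ) : ∀ a b c : ℕ, 4 * a + 3 * b + 4 * c < n → u ^ a * v ^ b * w ^ c ∈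
      Submodule.span A (Set.range fun m : nrm k => u ^ m.1.1 * v ^ m.1.2.1 * w ^ m.1.2.2) := by
  set M := Submodule.span A (Set.range fun m : nrm k => u ^ m.1.1 * v ^ m.1.2.1 * w ^ m.1.2.2)
    with hM
  rw [aux_binom, ← hs] at h3
  rw [aux_sum_s12] at hs
  set r := ∑ j ∈ range k, (-1 : B) ^ (j + 1) * ((k + 1).choose (j + 1) : B) * (u * w) ^ (k - j) *
        v ^ ((k + 3) * j) with hr
  have e1 : ((-1 : B) ^ (k + 1)) * (-1) ^ (k + 1) = 1 := by
    rw [← mul_pow]; simp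
  have hv : v ^ ((k + 3) * k) = (-1) ^ (k + 1) * (s - r) := by
    rw [hs]; linear_combination (-v ^ ((k + 3) * k)) * e1
  have hsgn : ∀ {x : B}, x ∈ M → (-1) ^ (k + 1) * x ∈ M := by
    intro x hx
    rcases neg_one_pow_eq_or B (k + 1) with h | h <;> rw [h] <;> simpa using hx
  have hA : ∀ {x : B} (t : A), x ∈ M → algebraMap A B t * x ∈ M := by
    intro x t hx
    rw [← Algebra.smul_def]; exact M.smul_mem t hx
  induction n with
  | zero => intro a b c h; omega
  | succ n ih =>
    intro a b c h
    -- the remainder times a monomial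
    have hrm : ∀ a' b' c' : ℕ, 4 * a' + 3 * (b' + (k + 3) * k) + 4 * c' ≤ n →
        u ^ a' * v ^ b' * w ^ c' * r ∈ M := by
      intro a' b' c' h'
      rw [hr, Finset.mul_sum]
      refine Submodule.sum_mem _ fun j hj => ?_
      have hj' := Finset.mem_range.1 hj
      obtain ⟨l, hl⟩ : ∃ l, k = j + l + 1 := ⟨k - j - 1, by omega⟩
      have := ih (a' + (k - j)) (b' + (k + 3) * j) (c' + (k - j)) (by
        rw [show k - j = l + 1 by omega]
        have : (k + 3) * k = (k + 3) * j + (k + 3) * (l + 1) := by rw [← mul_add]; congr 1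
        rw [this] at h'
        nlinarith)
      have h3 : u ^ a' * v ^ b' * w ^ c' *
          ((-1 : B) ^ (j + 1) * ((k + 1).choose (j + 1) : B) * (u * w) ^ (k - j) *
            v ^ ((k + 3) * j)) = algebraMap A B ((-1) ^ (j + 1) * ((k + 1).choose (j + 1) : A)) *
          (u ^ (a' + (k - j)) * v ^ (b' + (k + 3) * j) * w ^ (c' + (k - j))) := by
        simp only [map_mul, map_pow, map_neg, map_one, map_natCast, pow_add, mul_pow]
        ring
      rw [h3]
      exact hA _ this
    by_cases hc : k + 2 ≤ c
    · obtain ⟨c, rfl⟩ := Nat.exists_eq_add_of_le hc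
      have : u ^ a * v ^ b * w ^ (k + 2 + c) = algebraMap A B c1 * (u ^ a * v ^ (b + (k + 2)) * w ^ c)
          - algebraMap A B c0 * (u ^ (a + 1) * v ^ b * w ^ c) := by
        rw [pow_add w, pow_add v, pow_succ u]
        linear_combination (u ^ a * v ^ b * w ^ c) * h1
      rw [this]
      exact M.sub_mem (hA _ (ih _ _ _ (by omega))) (hA _ (ih _ _ _ (by omega)))
    by_cases ha : k + 2 ≤ a
    · obtain ⟨a, rfl⟩ := Nat.exists_eq_add_of_le ha
      have : u ^ (k + 2 + a) * v ^ b * w ^ c = algebraMap A B d1 * (u ^ a * v ^ (b + (k + 2)) * w ^ c)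
          - algebraMap A B d0 * (u ^ a * v ^ b * w ^ (c + 1)) := by
        rw [pow_add u, pow_add v, pow_succ w]
        linear_combination (u ^ a * v ^ b * w ^ c) * h2
      rw [this]
      exact M.sub_mem (hA _ (ih _ _ _ (by omega))) (hA _ (ih _ _ _ (by omega)))
    by_cases hb : (k + 3) * k + (k + 3) ≤ b
    · obtain ⟨b, rfl⟩ := Nat.exists_eq_add_of_le hb
      have : u ^ a * v ^ ((k + 3) * k + (k + 3) + b) * w ^ c = (-1) ^ (k + 1) * (
          algebraMap A B c0 * (algebraMap A B d0 * (u ^ a * v ^ b * w ^ c)) -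
          u ^ (a + (k + 1)) * v ^ b * w ^ (c + (k + 1)) - u ^ a * v ^ (b + (k + 3)) * w ^ c * r) := by
        rw [pow_add v, pow_add v, hv, pow_add u, pow_add w, pow_add v b]
        rw [mul_pow] at h3
        linear_combination (-(-1) ^ (k + 1) * (u ^ a * v ^ b * w ^ c)) * h3
      rw [this]
      refine hsgn (M.sub_mem (M.sub_mem (hA _ (hA _ (ih _ _ _ ?_))) (ih _ _ _ ?_)) (hrm _ _ _ ?_)) <;>
        nlinarith
    by_cases hab : 1 ≤ a ∧ (k + 3) * k + 1 ≤ b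
    · obtain ⟨ha', hb'⟩ := hab
      obtain ⟨a, rfl⟩ := Nat.exists_eq_add_of_le ha'
      obtain ⟨b, rfl⟩ := Nat.exists_eq_add_of_le hb'
      have : u ^ (1 + a) * v ^ ((k + 3) * k + 1 + b) * w ^ c = (-1) ^ (k + 1) * (
          algebraMap A B c1 * (algebraMap A B d0 * (u ^ a * v ^ b * w ^ c)) -
          algebraMap A B d1 * (u ^ a * v ^ b * w ^ (c + (k + 1))) -
           u ^ (a + 1) * v ^ (b + 1) * w ^ c * r) := by
        rw [pow_add v, pow_add v, hv, pow_add u, pow_add w, pow_add v b, pow_add u]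
        linear_combination (-(-1) ^ (k + 1) * (u ^ a * v ^ b * w ^ c)) * h4
      rw [this]
      refine hsgn (M.sub_mem (M.sub_mem (hA _ (hA _ (ih _ _ _ ?_))) (hA _ (ih _ _ _ ?_)))
        (hrm _ _ _ ?_)) <;> nlinarith
    by_cases hcb : 1 ≤ c ∧ (k + 3) * k + 1 ≤ b
    · obtain ⟨ha', hb'⟩ := hcb
      obtain ⟨c, rfl⟩ := Nat.exists_eq_add_of_le ha'
      obtain ⟨b, rfl⟩ := Nat.exists_eq_add_of_le hb'
      have : u ^ a * v ^ ((k + 3) * k + 1 + b) * w ^ (1 + c) = (-1) ^ (k + 1) * (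
          algebraMap A B c0 * (algebraMap A B d1 * (u ^ a * v ^ b * w ^ c)) -
          algebraMap A B c1 * (u ^ (a + (k + 1)) * v ^ b * w ^ c) -
           u ^ a * v ^ (b + 1) * w ^ (c + 1) * r) := by
        rw [pow_add v, pow_add v, hv, pow_add u, pow_add w, pow_add v b, pow_add w]
        linear_combination (-(-1) ^ (k + 1) * (u ^ a * v ^ b * w ^ c)) * h5
      rw [this]
      refine hsgn (M.sub_mem (M.sub_mem (hA _ (hA _ (ih _ _ _ ?_))) (hA _ (ih _ _ _ ?_)))
        (hrm _ _ _ ?_)) <;> nlinarith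
    have hm : (a, b, c) ∈ nrm k := by
      simp only [nrm, mem_union, mem_product, mem_range, mem_image, Prod.mk.injEq]
      by_cases hb' : b < (k + 3) * k + 1
      · left; omega
      · right
        refine ⟨b - ((k + 3) * k + 1), ?_, ?_, ?_, ?_⟩ <;> omega
    exact Submodule.subset_span ⟨⟨_, hm⟩, rfl⟩

/-- The Dickson equation. -/
lemma dickson {R : Type*} [CommRing R] [IsDomain R] (q k : ℕ) (hk : q = k + 2)
    (frob : ∀ a b : R, (a - b) ^ q = a ^ q - b ^ q) (x1 x2 c1 : R)
    (hd : x1 * x2 ^ q - x2 * x1 ^ q ≠ 0)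
    (hc1 : c1 * (x1 * x2 ^ q - x2 * x1 ^ q) = x1 * x2 ^ q ^ 2 - x2 * x1 ^ q ^ 2) :
    (x1 ^ q ^ 2 - c1 * x1 ^ q + (x1 * x2 ^ q - x2 * x1 ^ q) ^ (k + 1) * x1 = 0) ∧
    (x2 ^ q ^ 2 - c1 * x2 ^ q + (x1 * x2 ^ q - x2 * x1 ^ q) ^ (k + 1) * x2 = 0) := by
  have h := frob (x1 * x2 ^ q) (x2 * x1 ^ q)
  rw [mul_pow, mul_pow, ← pow_mul, ← pow_mul, ← pow_two] at h
  have h' : (x1 * x2 ^ q - x2 * x1 ^ q) ^ q = (x1 * x2 ^ q - x2 * x1 ^ q) ^ (k + 1) *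
    (x1 * x2 ^ q - x2 * x1 ^ q) := by rw [← pow_succ, hk]
  rw [h'] at h
  constructor
  · apply mul_right_cancel₀ hd
    linear_combination x1 * h - x1 ^ q * hc1
  · apply mul_right_cancel₀ hd
    linear_combination x2 * h - x2 ^ q * hc1

lemma rels {R : Type*} [CommRing R] [IsDomain R] (q k : ℕ) (hk : q = k + 2)
    (frob : ∀ a b : R, (a - b) ^ q = a ^ q - b ^ q)
    (frob' : ∀ a b : R, (a + b) ^ q = a ^ q + b ^ q) (x1 x2 y1 y2 c0 c1 c0s c1s um1 u0 u1 s : R)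
    (hd : x1 * x2 ^ q - x2 * x1 ^ q ≠ 0)
    (hc0 : c0 = (x1 * x2 ^ q - x2 * x1 ^ q) ^ (k + 1))
    (hc1 : c1 * (x1 * x2 ^ q - x2 * x1 ^ q) = x1 * x2 ^ q ^ 2 - x2 * x1 ^ q ^ 2)
    (hds : y2 * y1 ^ q - y1 * y2 ^ q ≠ 0)
    (hc0s : c0s = (y2 * y1 ^ q - y1 * y2 ^ q) ^ (k + 1))
    (hc1s : c1s * (y2 * y1 ^ q - y1 * y2 ^ q) = y2 * y1 ^ q ^ 2 - y1 * y2 ^ q ^ 2)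
    (hum1 : um1 = x1 * y1 ^ q + x2 * y2 ^ q)
    (hu0 : u0 = x1 * y1 + x2 * y2)
    (hu1 : u1 = x1 ^ q * y1 + x2 ^ q * y2) (hu : u0 ≠ 0)
    (hs : s = ∑ i ∈ Icc 1 (k + 1), (-1 : R) ^ i * ((k + 1).choose i : R) *
      (um1 * u1) ^ (k + 1 - i) * u0 ^ ((k + 2 + 1) * (i - 1))) :
    c0 * um1 - c1 * u0 ^ (k + 2) + u1 ^ (k + 2) = 0 ∧
    c0s * u1 - c1s * u0 ^ (k + 2) + um1 ^ (k + 2) = 0 ∧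
    c0 * c0s - (um1 * u1 - u0 ^ (k + 2 + 1)) ^ (k + 1) = 0 ∧
    c1 * c0s - c1s * u1 ^ (k + 1) - um1 * u0 * s = 0 ∧
    c0 * c1s - c1 * um1 ^ (k + 1) - u0 * u1 * s = 0 := by
  obtain ⟨dx1, dx2⟩ := dickson q k hk frob x1 x2 c1 hd hc1
  obtain ⟨dy2, dy1⟩ := dickson q k hk frob y2 y1 c1s hds hc1s
  rw [← hc0] at dx1 dx2
  rw [← hc0s] at dy1 dy2
  have f0 : u0 ^ q = x1 ^ q * y1 ^ q + x2 ^ q * y2 ^ q := by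
    rw [hu0, frob', mul_pow, mul_pow]
  have f1 : u1 ^ q = x1 ^ q ^ 2 * y1 ^ q + x2 ^ q ^ 2 * y2 ^ q := by
    rw [hu1, frob', mul_pow, mul_pow, ← pow_mul, ← pow_mul, ← pow_two]
  have f2 : um1 ^ q = x1 ^ q * y1 ^ q ^ 2 + x2 ^ q * y2 ^ q ^ 2 := by
    rw [hum1, frob', mul_pow, mul_pow, ← pow_mul, ← pow_mul, ← pow_two]
  have t1 : c0 * um1 - c1 * u0 ^ q + u1 ^ q = 0 := by
    rw [f0, f1, hum1]; linear_combination y1 ^ q * dx1 + y2 ^ q * dx2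
  have t2 : c0s * u1 - c1s * u0 ^ q + um1 ^ q = 0 := by
    rw [f0, f2, hu1]; linear_combination x1 ^ q * dy1 + x2 ^ q * dy2
  have t3 : c0 * c0s = (um1 * u1 - u0 ^ (k + 2 + 1)) ^ (k + 1) := by
    rw [hc0, hc0s, ← mul_pow, ← hk, pow_succ u0, f0, hum1, hu1, hu0]
    ring
  have t3' := t3
  rw [aux_binom, ← hs] at t3'
  rw [hk] at t1 t2
  have hu' : u0 ^ (k + 2) ≠ 0 := pow_ne_zero _ hu
  refine ⟨t1, t2, by rw [t3, sub_self], ?_, ?_⟩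
  · apply mul_right_cancel₀ hu'
    rw [mul_pow] at t3'
    linear_combination (-c0s) * t1 + u1 ^ (k + 1) * t2 + um1 * t3'
  · apply mul_right_cancel₀ hu'
    rw [mul_pow] at t3'
    linear_combination (-c0) * t2 + um1 ^ (k + 1) * t1 + u1 * t3'

lemma algInd {F : Type} [Field F] (q k : ℕ) (hk : q = k + 2)
    (c : Fin 4 → MvPolynomial (Fin 4) F)
    (h0 : X 0 ^ q ^ 2 - c 1 * X 0 ^ q + c 0 * X 0 = 0)
    (h1 : X 1 ^ q ^ 2 - c 1 * X 1 ^ q + c 0 * X 1 = 0)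
    (h2 : X 2 ^ q ^ 2 - c 3 * X 2 ^ q + c 2 * X 2 = 0)
    (h3 : X 3 ^ q ^ 2 - c 3 * X 3 ^ q + c 2 * X 3 = 0) : AlgebraicIndependent F c := by
  have key : ∀ (x : MvPolynomial (Fin 4) F) (i j : Fin 4),
      x ^ q ^ 2 - c i * x ^ q + c j * x = 0 →
      IsIntegral (Algebra.adjoin F (Set.range c)) x := by
    intro x i j h
    let a : Algebra.adjoin F (Set.range c) := ⟨c i, Algebra.subset_adjoin ⟨i, rfl⟩⟩
    let b : Algebra.adjoin F (Set.range c) := ⟨c j, Algebra.subset_adjoin ⟨j, rfl⟩⟩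
    have hlt : q < q ^ 2 := by rw [hk]; nlinarith
    refine ⟨Polynomial.X ^ q ^ 2 + (- Polynomial.C a * Polynomial.X ^ q +
      Polynomial.C b * Polynomial.X), ?_, ?_⟩
    · apply Polynomial.monic_X_pow_add
      refine lt_of_le_of_lt (b := (q : WithBot ℕ)) ?_ (by exact_mod_cast hlt)
      refine (Polynomial.degree_add_le _ _).trans (max_le ?_ ?_)
      · rw [← Polynomial.C_neg]; exact Polynomial.degree_C_mul_X_pow_le _ _
      · refine (Polynomial.degree_C_mul_X_le _).trans ?_
        exact_mod_cast (by omega : 1 ≤ q)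
    · simp only [Polynomial.eval₂_add, Polynomial.eval₂_mul, Polynomial.eval₂_neg,
        Polynomial.eval₂_pow, Polynomial.eval₂_X, Polynomial.eval₂_C]
      change x ^ q ^ 2 + (- (c i) * x ^ q + c j * x) = 0
      linear_combination h
  have hint : Algebra.IsIntegral (Algebra.adjoin F (Set.range c)) (MvPolynomial (Fin 4) F) := by
    refine ⟨fun f => ?_⟩
    induction f using MvPolynomial.induction_on with
    | C a =>
      exact isIntegral_algebraMap (x := algebraMap F (Algebra.adjoin F (Set.range c)) a)
    | add f g hf hg => exact hf.add hg
    | mul_X f i hf =>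
      refine hf.mul ?_
      fin_cases i
      · exact key _ _ _ h0
      · exact key _ _ _ h1
      · exact key _ _ _ h2
      · exact key _ _ _ h3
  have : Algebra.IsAlgebraic (Algebra.adjoin F (Set.range c)) (MvPolynomial (Fin 4) F) :=
    inferInstance
  refine (Algebra.IsAlgebraic.isTranscendenceBasis_of_le_trdeg_of_finite F c ?_).1
  rw [MvPolynomial.trdeg_of_isDomain]
  simp

lemma indep {K G : Type*} [Field K] [Fintype G] (k : ℕ)
    (c0 c1 d0 d1 : K) (u v w s : G → K)
    (hs : s = ∑ i ∈ Icc 1 (k + 1), (-1 : G → K) ^ i * ((k + 1).choose i : G → K) *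
      (u * w) ^ (k + 1 - i) * v ^ ((k + 2 + 1) * (i - 1)))
    (h1 : algebraMap K (G → K) c0 * u - algebraMap K (G → K) c1 * v ^ (k + 2) + w ^ (k + 2) = 0)
    (h2 : algebraMap K (G → K) d0 * w - algebraMap K (G → K) d1 * v ^ (k + 2) + u ^ (k + 2) = 0)
    (h3 : algebraMap K (G → K) c0 * algebraMap K (G → K) d0
      - (u * w - v ^ (k + 2 + 1)) ^ (k + 1) = 0)
    (h4 : algebraMap K (G → K) c1 * algebraMap K (G → K) d0
      - algebraMap K (G → K) d1 * w ^ (k + 1) - u * v * s = 0)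
    (h5 : algebraMap K (G → K) c0 * algebraMap K (G → K) d1
      - algebraMap K (G → K) c1 * u ^ (k + 1) - v * w * s = 0)
    (hv : Function.Injective v) (hG : (nrm k).card ≤ Fintype.card G) :
    LinearIndependent K (fun m : nrm k => u ^ m.1.1 * v ^ m.1.2.1 * w ^ m.1.2.2) := by
  classical
  refine linearIndependent_of_top_le_span_of_card_le_finrank ?_ ?_
  · intro f _
    have hf : f = Polynomial.aeval v (Lagrange.interpolate univ v f) := by
      funext g
      have := Lagrange.eval_interpolate_at_node (s := univ) (v := v) f hv.injOn (mem_univ g)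
      rw [← this]
      have e := Polynomial.aeval_algHom_apply (Pi.evalAlgHom K (fun _ : G => K) g) v
        (Lagrange.interpolate univ v f)
      simp only [Pi.evalAlgHom_apply] at e
      rw [← e, Polynomial.coe_aeval_eq_eval]
    rw [hf, Polynomial.aeval_eq_sum_range]
    refine Submodule.sum_mem _ fun i _ => Submodule.smul_mem _ _ ?_
    have := mon_mem k c0 c1 d0 d1 u v w s hs h1 h2 h3 h4 h5 _ 0 i 0 (Nat.lt_succ_self _)
    simpa using this
  · simpa using hG

/-- Every element of the quotient is a combination of normal monomials. -/
lemma quot_span {F : Type} [Field F] (k : ℕ) (B : Type) [CommRing B] [Algebra F B]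
    (f : MvPolynomial (Fin 7) F →ₐ[F] B) (s : MvPolynomial (Fin 7) F)
    (hs : s = ∑ i ∈ Icc 1 (k + 1),
        (-1 : MvPolynomial (Fin 7) F) ^ i * ((k + 1).choose i : MvPolynomial (Fin 7) F) *
          (X 4 * X 6) ^ (k + 1 - i) * X 5 ^ ((k + 2 + 1) * (i - 1)))
    (h1 : f (X 0 * X 4 - X 1 * X 5 ^ (k + 2) + X 6 ^ (k + 2)) = 0)
    (h2 : f (X 2 * X 6 - X 3 * X 5 ^ (k + 2) + X 4 ^ (k + 2)) = 0)
    (h3 : f (X 0 * X 2 - (X 4 * X 6 - X 5 ^ (k + 2 + 1)) ^ (k + 1)) = 0)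
    (h4 : f (X 1 * X 2 - X 3 * X 6 ^ (k + 1) - X 4 * X 5 * s) = 0)
    (h5 : f (X 0 * X 3 - X 1 * X 4 ^ (k + 1) - X 5 * X 6 * s) = 0)
    (z : MvPolynomial (Fin 7) F) :
    ∃ a : nrm k → MvPolynomial (Fin 4) F, f z = ∑ m : nrm k,
      f (rename (Fin.castLE (by omega)) (a m)) *
        (f (X 4) ^ m.1.1 * f (X 5) ^ m.1.2.1 * f (X 6) ^ m.1.2.2) := by
  let g : MvPolynomial (Fin 4) F →+* B := f.toRingHom.comp
    (rename (R := F) (Fin.castLE (by omega : 4 ≤ 7))).toRingHom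
  let : Algebra (MvPolynomial (Fin 4) F) B := g.toAlgebra
  have hg : ∀ t, algebraMap (MvPolynomial (Fin 4) F) B t =
    f (rename (Fin.castLE (by omega)) t) := fun t => rfl
  have hX : ∀ i : Fin 4, algebraMap (MvPolynomial (Fin 4) F) B (X i) =
    f (X (Fin.castLE (by omega) i)) := fun i => by rw [hg, rename_X]
  have X0 : algebraMap (MvPolynomial (Fin 4) F) B (X 0) = f (X 0) := hX 0
  have X1 : algebraMap (MvPolynomial (Fin 4) F) B (X 1) = f (X 1) := hX 1
  have X2 : algebraMap (MvPolynomial (Fin 4) F) B (X 2) = f (X 2) := hX 2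
  have X3 : algebraMap (MvPolynomial (Fin 4) F) B (X 3) = f (X 3) := hX 3
  have hm := fun a b c => mon_mem (A := MvPolynomial (Fin 4) F) (B := B) k (X 0) (X 1) (X 2) (X 3)
    (f (X 4)) (f (X 5)) (f (X 6)) (f s) (by rw [hs]; simp [map_sum])
    (by rw [X0, X1, ← h1]; simp) (by rw [X2, X3, ← h2]; simp) (by rw [X0, X2, ← h3]; simp)
    (by rw [X1, X2, X3, ← h4]; simp) (by rw [X0, X1, X3, ← h5]; simp) _ a b c
    (Nat.lt_succ_self _)
  set M := Submodule.span (MvPolynomial (Fin 4) F) (Set.range fun m : nrm k =>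
    f (X 4) ^ m.1.1 * f (X 5) ^ m.1.2.1 * f (X 6) ^ m.1.2.2) with hM
  have hz : f z ∈ M := by
    induction z using MvPolynomial.induction_on with
    | C a =>
      have := M.smul_mem (C a) (hm 0 0 0)
      rw [Algebra.smul_def, hg, rename_C] at this
      simpa using this
    | add p q hp hq => rw [map_add]; exact M.add_mem hp hq
    | mul_X p i hp =>
      have hU : ∀ y : B, (∀ a b c, f (X 4) ^ a * f (X 5) ^ b * f (X 6) ^ c * y ∈ M) →
          f p * y ∈ M := by
        intro y hy
        generalize f p = y0 at hp ⊢
        induction hp using Submodule.span_induction with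
        | mem x hx => obtain ⟨m, rfl⟩ := hx; exact hy _ _ _
        | zero => simp
        | add x x' _ _ h h' => rw [add_mul]; exact M.add_mem h h'
        | smul t x _ h => rw [smul_mul_assoc]; exact M.smul_mem _ h
      have hS : ∀ j : Fin 4, f p * algebraMap (MvPolynomial (Fin 4) F) B (X j) ∈ M := by
        intro j
        rw [mul_comm, ← Algebra.smul_def]; exact M.smul_mem _ hp
      rw [map_mul]
      fin_cases i
      · exact X0 ▸ hS 0
      · exact X1 ▸ hS 1
      · exact X2 ▸ hS 2
      · exact X3 ▸ hS 3
      · refine hU _ fun a b c => ?_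
        have := hm (a + 1) b c
        rw [pow_succ] at this
        convert this using 1
        change _ * f (X 4) = _
        ring
      · refine hU _ fun a b c => ?_
        have := hm a (b + 1) c
        rw [pow_succ] at this
        convert this using 1
        change _ * f (X 5) = _
        ring
      · refine hU _ fun a b c => ?_
        have := hm a b (c + 1)
        rw [pow_succ] at this
        convert this using 1
        change _ * f (X 6) = _
        ring
  obtain ⟨a, ha⟩ := (Submodule.mem_span_range_iff_exists_fun _).1 hz
  refine ⟨a, ?_⟩
  rw [← ha]
  refine Finset.sum_congr rfl fun m _ => ?_
  rw [Algebra.smul_def, hg]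

lemma card_GL2 (F : Type) [Field F] [Fintype F] (k : ℕ) (hF : Fintype.card F = k + 2) :
    Nat.card (GL (Fin 2) F) = ((k + 2) ^ 2 - 1) * ((k + 2) ^ 2 - (k + 2)) := by
  rw [Matrix.card_GL_field]
  simp [Fin.prod_univ_two, hF]

/-- Action of a matrix on the `x` variables. -/
noncomputable def act {F : Type} [Field F] (g : Matrix (Fin 2) (Fin 2) F) :
    MvPolynomial (Fin 4) F →ₐ[F] MvPolynomial (Fin 4) F :=
  aeval ![C (g 0 0) * X 0 + C (g 0 1) * X 1, C (g 1 0) * X 0 + C (g 1 1) * X 1, X 2, X 3]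

lemma act_inj {F : Type} [Field F] (g h : Matrix (Fin 2) (Fin 2) F)
    (H : act g (X 0 * X 2 + X 1 * X 3) = act h (X 0 * X 2 + X 1 * X 3)) : g = h := by
  have e : ∀ a b c d : F, aeval ![a, b, c, d] (act g (X 0 * X 2 + X 1 * X 3)) =
    aeval ![a, b, c, d] (act h (X 0 * X 2 + X 1 * X 3)) := fun a b c d => by rw [H]
  simp only [act, map_add, map_mul, aeval_X] at e
  simp at e
  ext i j
  fin_cases i <;> fin_cases j
  · simpa using e 1 0 1 0
  · simpa using e 0 1 1 0
  · simpa using e 1 0 0 1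
  · simpa using e 0 1 0 1

lemma act_d {F : Type} [Field F] (g : Matrix (Fin 2) (Fin 2) F) (Q : ℕ)
    (frob : ∀ a b : MvPolynomial (Fin 4) F, (a + b) ^ Q = a ^ Q + b ^ Q)
    (fF : ∀ a : F, a ^ Q = a) :
    act g (X 0 * X 1 ^ Q - X 1 * X 0 ^ Q) = C g.det * (X 0 * X 1 ^ Q - X 1 * X 0 ^ Q) := by
  simp only [act, map_sub, map_mul, map_pow, aeval_X]
  simp only [Matrix.cons_val]
  rw [frob, frob, Matrix.det_fin_two]
  simp only [mul_pow, ← C_pow, fF, C_sub, C_mul]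
  ring

/-- Main Theorem: `ker π = I`, i.e. every relation among the seven generators of the
invariant ring is generated by the five relations `T₁, T₁*, T₀₀, T₁₀, T₀₁`. -/
theorem stmt_12 (p e q : ℕ) (hp : p.Prime) (he : 1 ≤ e) (hq : q = p ^ e)
    (F : Type) [Field F] [Fintype F] (hF : Fintype.card F = q)
    (x1 x2 y1 y2 d1 d2 c0 c1 d1s d2s c0s c1s um1 u0 u1 : MvPolynomial (Fin 4) F)
    (hx1 : x1 = X 0) (hx2 : x2 = X 1) (hy1 : y1 = X 2) (hy2 : y2 = X 3)
    (hd1 : d1 = x1 * x2 ^ q ^ 2 - x2 * x1 ^ q ^ 2)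
    (hd2 : d2 = x1 * x2 ^ q - x2 * x1 ^ q)
    (hc0 : c0 = d2 ^ (q - 1))
    (hc1 : c1 * d2 = d1)
    (hd2s : d2s = y2 * y1 ^ q - y1 * y2 ^ q)
    (hd1s : d1s = y2 * y1 ^ q ^ 2 - y1 * y2 ^ q ^ 2)
    (hc0s : c0s = d2s ^ (q - 1))
    (hc1s : c1s * d2s = d1s)
    (hum1 : um1 = x1 * y1 ^ q + x2 * y2 ^ q)
    (hu0 : u0 = x1 * y1 + x2 * y2)
    (hu1 : u1 = x1 ^ q * y1 + x2 ^ q * y2)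
    (π : MvPolynomial (Fin 7) F →ₐ[F] MvPolynomial (Fin 4) F)
    (hπ : π = aeval ![c0, c1, c0s, c1s, um1, u0, u1])
    (T1 T1s T00 T10 T01 : MvPolynomial (Fin 7) F)
    (hT1 : T1 = X 0 * X 4 - X 1 * X 5 ^ q + X 6 ^ q)
    (hT1s : T1s = X 2 * X 6 - X 3 * X 5 ^ q + X 4 ^ q)
    (hT00 : T00 = X 0 * X 2 - (X 4 * X 6 - X 5 ^ (q + 1)) ^ (q - 1))
    (hT10 : T10 = X 1 * X 2 - X 3 * X 6 ^ (q - 1) -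
      X 4 * X 5 * ∑ i ∈ Icc 1 (q - 1),
        (-1 : MvPolynomial (Fin 7) F) ^ i * ((q - 1).choose i : MvPolynomial (Fin 7) F) *
          (X 4 * X 6) ^ (q - 1 - i) * X 5 ^ ((q + 1) * (i - 1)))
    (hT01 : T01 = X 0 * X 3 - X 1 * X 4 ^ (q - 1) -
      X 5 * X 6 * ∑ i ∈ Icc 1 (q - 1),
        (-1 : MvPolynomial (Fin 7) F) ^ i * ((q - 1).choose i : MvPolynomial (Fin 7) F) *
          (X 4 * X 6) ^ (q - 1 - i) * X 5 ^ ((q + 1) * (i - 1)))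
    (I : Ideal (MvPolynomial (Fin 7) F))
    (hI : I = Ideal.span {T1, T1s, T00, T10, T01}) :
    RingHom.ker π = I := by
  obtain ⟨k, hk⟩ : ∃ k, q = k + 2 := by
    have h1 : 1 < q := hF ▸ Fintype.one_lt_card
    exact ⟨q - 2, by omega⟩
  have hq1 : q - 1 = k + 1 := by omega
  have hpF : Fact p.Prime := ⟨hp⟩
  have hch : CharP F p := by
    have h0 : ((p : F)) ^ e = 0 := by
      rw [← Nat.cast_pow, ← hq, ← hF]; exact FiniteField.cast_card_eq_zero F
    have h0' : (p : F) = 0 := pow_eq_zero_iff (by omega) |>.1 h0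
    exact (CharP.charP_iff_prime_eq_zero hp).2 h0'
  have hchR : CharP (MvPolynomial (Fin 4) F) p := inferInstance
  have frobm : ∀ a b : MvPolynomial (Fin 4) F, (a - b) ^ q = a ^ q - b ^ q := fun a b => by
    rw [hq]; exact sub_pow_char_pow ..
  have frobp : ∀ a b : MvPolynomial (Fin 4) F, (a + b) ^ q = a ^ q + b ^ q := fun a b => by
    rw [hq]; exact add_pow_char_pow ..
  have frobp2 : ∀ a b : MvPolynomial (Fin 4) F, (a + b) ^ q ^ 2 = a ^ q ^ 2 + b ^ q ^ 2 :=
    fun a b => by rw [pow_two, pow_mul, pow_mul, pow_mul, frobp, frobp]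
  have fF : ∀ a : F, a ^ q = a := fun a => hF ▸ FiniteField.pow_card a
  have fF2 : ∀ a : F, a ^ q ^ 2 = a := fun a => by rw [pow_two, pow_mul, fF, fF]
  have hd2ne : d2 ≠ 0 := by
    intro h
    have h' := congrArg (aeval ![(Polynomial.X : Polynomial F), 1, 0, 0]) h
    rw [hd2, hx1, hx2] at h'
    simp at h'
    have h2 := congrArg (fun P => Polynomial.coeff P 1) h'
    rw [hk] at h2
    simp [Polynomial.coeff_X_pow] at h2
  have hd2sne : d2s ≠ 0 := by
    intro h
    have h' := congrArg (aeval ![(0 : Polynomial F), 0, 1, Polynomial.X]) h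
    rw [hd2s, hy1, hy2] at h'
    simp at h'
    have h2 := congrArg (fun P => Polynomial.coeff P 1) h'
    rw [hk] at h2
    simp [Polynomial.coeff_X_pow] at h2
  have hu0ne : u0 ≠ 0 := by
    intro h
    have h' := congrArg (aeval ![(1 : F), 0, 1, 0]) h
    rw [hu0, hx1, hx2, hy1, hy2] at h'
    simp at h'
  -- the relations hold in `R`
  obtain ⟨s, hs⟩ : ∃ s, s = ∑ i ∈ Icc 1 (k + 1), (-1 : MvPolynomial (Fin 4) F) ^ i *
      ((k + 1).choose i : MvPolynomial (Fin 4) F) *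
      (um1 * u1) ^ (k + 1 - i) * u0 ^ ((k + 2 + 1) * (i - 1)) := ⟨_, rfl⟩
  rw [hq1] at hc0 hc0s
  have hd2' := hd2ne
  have hd2s' := hd2sne
  obtain ⟨r1, r2, r3, r4, r5⟩ := rels q k hk frobm frobp x1 x2 y1 y2 c0 c1 c0s c1s um1 u0 u1 s
    (hd2 ▸ hd2ne) (hd2 ▸ hc0) (by rw [← hd2, ← hd1, hc1])
    (hd2s ▸ hd2sne) (hd2s ▸ hc0s) (by rw [← hd2s, ← hd1s, hc1s]) hum1 hu0 hu1 hu0ne hs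
  obtain ⟨t, ht⟩ : ∃ t, t = ∑ i ∈ Icc 1 (k + 1),
        (-1 : MvPolynomial (Fin 7) F) ^ i * ((k + 1).choose i : MvPolynomial (Fin 7) F) *
          (X 4 * X 6) ^ (k + 1 - i) * X 5 ^ ((k + 2 + 1) * (i - 1)) := ⟨_, rfl⟩
  rw [hq1, hk, ← ht] at hT10 hT01
  rw [hq1, hk] at hT00
  rw [hk] at hT1 hT1s
  have p0 : π (X 0) = c0 := by rw [hπ, aeval_X]; rfl
  have p1 : π (X 1) = c1 := by rw [hπ, aeval_X]; rfl
  have p2 : π (X 2) = c0s := by rw [hπ, aeval_X]; rfl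
  have p3 : π (X 3) = c1s := by rw [hπ, aeval_X]; rfl
  have p4 : π (X 4) = um1 := by rw [hπ, aeval_X]; rfl
  have p5 : π (X 5) = u0 := by rw [hπ, aeval_X]; rfl
  have p6 : π (X 6) = u1 := by rw [hπ, aeval_X]; rfl
  have pt : π t = s := by
    rw [ht, hs, map_sum]
    refine Finset.sum_congr rfl fun i _ => ?_
    simp only [map_mul, map_pow, map_neg, map_one, map_natCast, p4, p5, p6]
  have hIle : I ≤ RingHom.ker π := by
    rw [hI, Ideal.span_le]
    rintro z (rfl | rfl | rfl | rfl | rfl)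
    · simp only [SetLike.mem_coe, RingHom.mem_ker, hT1, map_add, map_sub, map_mul, map_pow,
        p0, p1, p4, p5, p6, r1]
    · simp only [SetLike.mem_coe, RingHom.mem_ker, hT1s, map_add, map_sub, map_mul, map_pow,
        p2, p3, p4, p5, p6, r2]
    · simp only [SetLike.mem_coe, RingHom.mem_ker, hT00, map_sub, map_mul, map_pow,
        p0, p2, p4, p5, p6, r3]
    · simp only [SetLike.mem_coe, RingHom.mem_ker, hT10, map_sub, map_mul, map_pow,
        p1, p2, p3, p4, p5, p6, pt, r4]
    · simp only [SetLike.mem_coe, RingHom.mem_ker, hT01, map_sub, map_mul, map_pow,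
        p0, p1, p3, p4, p5, p6, pt, r5]
  refine le_antisymm ?_ hIle
  intro z hz
  have hz0 : π z = 0 := hz
  have hmem : ∀ T, T ∈ ({T1, T1s, T00, T10, T01} : Set (MvPolynomial (Fin 7) F)) →
      Ideal.Quotient.mkₐ F I T = 0 := by
    intro T hT
    rw [Ideal.Quotient.mkₐ_eq_mk, Ideal.Quotient.eq_zero_iff_mem, hI]
    exact Ideal.subset_span hT
  obtain ⟨a, ha⟩ := quot_span k (MvPolynomial (Fin 7) F ⧸ I) (Ideal.Quotient.mkₐ F I) t ht
    (hT1 ▸ hmem T1 (by simp)) (hT1s ▸ hmem T1s (by simp)) (hT00 ▸ hmem T00 (by simp))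
    (hT10 ▸ hmem T10 (by simp)) (hT01 ▸ hmem T01 (by simp)) z
  -- algebraic independence of the Dickson invariants
  obtain ⟨dx1, dx2⟩ := dickson q k hk frobm x1 x2 c1 (hd2 ▸ hd2ne) (by rw [← hd2, ← hd1, hc1])
  obtain ⟨dy2, dy1⟩ := dickson q k hk frobm y2 y1 c1s (hd2s ▸ hd2sne)
    (by rw [← hd2s, ← hd1s, hc1s])
  rw [← hd2, ← hc0] at dx1 dx2
  rw [← hd2s, ← hc0s] at dy1 dy2
  have hind : AlgebraicIndependent F ![c0, c1, c0s, c1s] := by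
    refine algInd q k hk _ ?_ ?_ ?_ ?_
    · rw [hx1] at dx1; exact dx1
    · rw [hx2] at dx2; exact dx2
    · rw [hy1] at dy1; exact dy1
    · rw [hy2] at dy2; exact dy2
  have hren : ∀ b : MvPolynomial (Fin 4) F, π (rename (Fin.castLE (by omega)) b) =
      aeval ![c0, c1, c0s, c1s] b := by
    intro b
    rw [hπ, aeval_rename]
    congr 2
    funext i
    fin_cases i <;> rfl
  -- the relation in `R`
  have hR : ∑ m : nrm k, aeval ![c0, c1, c0s, c1s] (a m) *
      (um1 ^ m.1.1 * u0 ^ m.1.2.1 * u1 ^ m.1.2.2) = 0 := by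
    have h1 : z - ∑ m : nrm k, rename (Fin.castLE (by omega)) (a m) *
        (X 4 ^ m.1.1 * X 5 ^ m.1.2.1 * X 6 ^ m.1.2.2) ∈ I := by
      rw [← Ideal.Quotient.eq_zero_iff_mem, ← Ideal.Quotient.mkₐ_eq_mk F, map_sub, ha, map_sum]
      simp only [map_mul, map_pow, sub_self]
    have h2 : π _ = 0 := hIle h1
    rw [map_sub, hz0, zero_sub, neg_eq_zero, map_sum] at h2
    rw [← h2]
    refine Finset.sum_congr rfl fun m _ => ?_
    simp only [map_mul, map_pow, p4, p5, p6, hren]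
  -- invariance
  classical
  have hfix : ∀ g : GL (Fin 2) F, act g.1 c0 = c0 ∧ act g.1 c1 = c1 ∧ act g.1 c0s = c0s ∧
      act g.1 c1s = c1s := by
    intro g
    have hdet : g.1.det ≠ 0 := by
      have := g.isUnit
      rw [Matrix.isUnit_iff_isUnit_det] at this
      exact this.ne_zero
    have e2 : act g.1 d2 = C g.1.det * d2 := by
      rw [hd2, hx1, hx2]; exact act_d g.1 q frobp fF
    have e1 : act g.1 d1 = C g.1.det * d1 := by
      rw [hd1, hx1, hx2]; exact act_d g.1 (q ^ 2) frobp2 fF2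
    have ey1 : act g.1 y1 = y1 := by rw [hy1, act, aeval_X]; rfl
    have ey2 : act g.1 y2 = y2 := by rw [hy2, act, aeval_X]; rfl
    have e2s : act g.1 d2s = d2s := by
      rw [hd2s]; simp only [map_sub, map_mul, map_pow, ey1, ey2]
    have e1s : act g.1 d1s = d1s := by
      rw [hd1s]; simp only [map_sub, map_mul, map_pow, ey1, ey2]
    refine ⟨?_, ?_, ?_, ?_⟩
    · rw [hc0, map_pow, e2, mul_pow, ← C_pow]
      have : g.1.det ^ (k + 1) = 1 := by
        have := FiniteField.pow_card_sub_one_eq_one g.1.det hdet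
        rwa [hF, hq1] at this
      rw [this, C_1, one_mul]
    · have h := congrArg (act g.1) hc1
      rw [map_mul, e2, e1, ← hc1] at h
      have hCd : (C g.1.det : MvPolynomial (Fin 4) F) * d2 ≠ 0 :=
        mul_ne_zero (by simpa using hdet) hd2ne
      apply mul_right_cancel₀ hCd
      rw [h]; ring
    · rw [hc0s, map_pow, e2s]
    · have h := congrArg (act g.1) hc1s
      rw [map_mul, e2s, e1s, ← hc1s] at h
      exact mul_right_cancel₀ hd2sne h
  let K := FractionRing (MvPolynomial (Fin 4) F)
  let ι : MvPolynomial (Fin 4) F →+* K := algebraMap _ K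
  have hι : Function.Injective ι := IsFractionRing.injective _ _
  let Φ : MvPolynomial (Fin 4) F →+* (GL (Fin 2) F → K) :=
    RingHom.pi fun g => ι.comp (act g.1).toRingHom
  have hΦ : ∀ b g, Φ b g = ι (act g.1 b) := fun b g => rfl
  have hΦc : ∀ b, (∀ g : GL (Fin 2) F, act g.1 b = b) →
      algebraMap K (GL (Fin 2) F → K) (ι b) = Φ b := by
    intro b hb
    funext g
    rw [hΦ, hb]; rfl
  have q0 := hΦc c0 fun g => (hfix g).1
  have q1 := hΦc c1 fun g => (hfix g).2.1
  have q2 := hΦc c0s fun g => (hfix g).2.2.1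
  have q3 := hΦc c1s fun g => (hfix g).2.2.2
  have hli := indep (K := K) (G := GL (Fin 2) F) k (ι c0) (ι c1) (ι c0s) (ι c1s)
    (Φ um1) (Φ u0) (Φ u1) (Φ s)
    (by
      rw [hs, map_sum]
      refine Finset.sum_congr rfl fun i _ => ?_
      simp only [map_mul, map_pow, map_neg, map_one, map_natCast])
    (by rw [q0, q1, ← map_zero Φ, ← r1]; simp only [map_mul, map_pow, map_sub, map_add])
    (by rw [q2, q3, ← map_zero Φ, ← r2]; simp only [map_mul, map_pow, map_sub, map_add])
    (by rw [q0, q2, ← map_zero Φ, ← r3]; simp only [map_mul, map_pow, map_sub])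
    (by rw [q1, q2, q3, ← map_zero Φ, ← r4]; simp only [map_mul, map_pow, map_sub])
    (by rw [q0, q1, q3, ← map_zero Φ, ← r5]; simp only [map_mul, map_pow, map_sub])
    (by
      intro g h hgh
      rw [hΦ, hΦ] at hgh
      have := hι hgh
      rw [hu0, hx1, hx2, hy1, hy2] at this
      exact Units.ext (act_inj _ _ this))
    (by
      rw [← Nat.card_eq_fintype_card, card_GL2 F k (hF.trans hk)]
      exact card_nrm k)
  rw [Fintype.linearIndependent_iff] at hli
  have hcoef := hli (fun m => ι (aeval ![c0, c1, c0s, c1s] (a m))) (by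
    rw [← map_zero Φ, ← hR, map_sum]
    refine Finset.sum_congr rfl fun m _ => ?_
    rw [Algebra.smul_def, map_mul, map_mul, map_mul, map_pow, map_pow, map_pow]
    congr 1
    apply hΦc
    intro g
    obtain ⟨g0, g1, g2, g3⟩ := hfix g
    rw [comp_aeval_apply]
    congr 2
    funext i
    fin_cases i
    · exact g0
    · exact g1
    · exact g2
    · exact g3)
  have ha0 : ∀ m, a m = 0 := by
    intro m
    have h1 : aeval ![c0, c1, c0s, c1s] (a m) = 0 := hι ((hcoef m).trans (map_zero ι).symm)
    exact hind (h1.trans (map_zero _).symm)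
  rw [← Ideal.Quotient.eq_zero_iff_mem, ← Ideal.Quotient.mkₐ_eq_mk F, ha]
  simp [ha0]
end
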